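/- Fix integers m₀ ≥ 1 and k ≥ 1. Then there exists N such that for all n ≥ N one has 𝒫_{n,k}(m₀)² ≥ 𝒫_{n,k−1}(m₀)·𝒫_{n,k+1}(m₀) and 𝒬_{n,k}(m₀)² ≥ 𝒬_{n,k−1}(m₀)·𝒬_{n,k+1}(m₀). Moreover, if m₀ > 1 then both inequalities are strict for all sufficiently large n. -/

import Mathlib

open Polynomial

/-- The ring `ℚ[m][t]`: polynomials in `t` with coefficients in `ℚ[m]`. -/
abbrev Qmt : Type := Polynomial (Polynomial ℚ)

/-- The element `m` of `ℚ[m][t]`. -/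
noncomputable def mPoly : Qmt := Polynomial.C Polynomial.X

/-- `f^{[d]}`: substitute `t ↦ t^d`, leaving `m` unchanged. -/
noncomputable def tPow (d : ℕ) (f : Qmt) : Qmt := f.comp (Polynomial.X ^ d)

/-- `f^{[μ]} = f^{[μ₁]} ⋯ f^{[μ_ℓ]}` for a multiset `μ` of positive integers. -/
noncomputable def tPowMul (μ : Multiset ℕ) (f : Qmt) : Qmt := (μ.map (fun d => tPow d f)).prod

/-- `z_μ = ∏ i, i ^ (mult of i) * (mult of i)!`. -/
def zPart (μ : Multiset ℕ) : ℕ := ∏ i ∈ μ.toFinset, i ^ μ.count i * (μ.count i).factorial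

/-- The plethysm `h_r ∘ f = Σ_{μ ⊢ r} z_μ⁻¹ f^{[μ]}`. -/
noncomputable def plethH (r : ℕ) (f : Qmt) : Qmt :=
  ∑ μ : Nat.Partition r, Polynomial.C (Polynomial.C ((zPart μ.parts : ℚ)⁻¹)) * tPowMul μ.parts f

/-- The polynomials `𝒬ₙ⁺ ∈ ℚ[m][t]`: `𝒬₁⁺ = m` and, for `n ≥ 2`,
`𝒬ₙ⁺ = Σ_{λ ⊢ n} (Σ_{i=1}^{ℓ(λ)-2} t^i) ∏_j (h_{r_j} ∘ 𝒬⁺_{n_j})` where `n_j` are the distinct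
parts of `λ` with multiplicities `r_j`.  (The recursion is well-founded: the term of `λ = (n)`
has coefficient `Σ_{i=1}^{1-2} t^i = 0`, so the guard `p < n` does not change any value.) -/
noncomputable def Qplus : ℕ → Qmt := fun n =>
  Nat.strongRecOn n fun n ih =>
    if n = 1 then mPoly
    else
      ∑ lam : Nat.Partition n,
        (∑ i ∈ Finset.Icc 1 (Multiset.card lam.parts - 2), (Polynomial.X : Qmt) ^ i) *
          ∏ p ∈ lam.parts.toFinset,
            plethH (lam.parts.count p) (if h : p < n then ih p h else 0)

/-- The polynomials `𝒬ₙ ∈ ℚ[m][t]`: `𝒬₁ = m` and, for `n ≥ 2`,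
`𝒬ₙ = Σ_{λ ⊢ n} ∏_j (h_{r_j} ∘ 𝒬⁺_{n_j})`. -/
noncomputable def Qfull (n : ℕ) : Qmt :=
  if n = 1 then mPoly
  else ∑ lam : Nat.Partition n, ∏ p ∈ lam.parts.toFinset, plethH (lam.parts.count p) (Qplus p)

/-- `𝒬_{n,k}(m)`: the coefficient of `t^k` in `𝒬ₙ`, a polynomial in `m`. -/
noncomputable def Qnk (n k : ℕ) : Polynomial ℚ := (Qfull n).coeff k

/-- The right-hand side `𝒬ₙ − (t/2)(Σ_{h=2}^{n-2} 𝒬_h 𝒬_{n-h} − 𝒬_{n/2}^{[2]})` of the relation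
defining `𝒫ₙ`, where `𝒬_{n/2} = 0` when `n` is odd. -/
noncomputable def Prhs (n : ℕ) : Qmt :=
  Qfull n -
    Polynomial.C (Polynomial.C ((2 : ℚ)⁻¹)) * Polynomial.X *
      ((∑ h ∈ Finset.Icc 2 (n - 2), Qfull h * Qfull (n - h)) -
        (if 2 ∣ n then tPow 2 (Qfull (n / 2)) else 0))

/-- `c_k = (k+1)^{k-1}/k!`. -/
noncomputable def ck (k : ℕ) : ℚ := ((k : ℚ) + 1) ^ ((k : ℤ) - 1) / (k.factorial : ℚ)

/-- `d_k = (k+1)^{k-2}/k!`. -/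
noncomputable def dk (k : ℕ) : ℚ := ((k : ℚ) + 1) ^ ((k : ℤ) - 2) / (k.factorial : ℚ)

/-- The power series `f(x^d)`; for `d = 0` this is junk. -/
noncomputable def dilate {R : Type*} [CommRing R] (d : ℕ) (f : PowerSeries R) : PowerSeries R :=
  PowerSeries.mk fun n => if d ∣ n then PowerSeries.coeff (n / d) f else 0

theorem dilate_eq_expand {R : Type*} [CommRing R] {d : ℕ} (hd : d ≠ 0) (f : PowerSeries R) :
    dilate d f = PowerSeries.expand d hd f := by
  ext n
  simp [dilate, PowerSeries.coeff_expand]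

theorem coeff_dilate {R : Type*} [CommRing R] (d n : ℕ) (f : PowerSeries R) :
    PowerSeries.coeff n (dilate d f) = if d ∣ n then PowerSeries.coeff (n / d) f else 0 := by
  simp [dilate]

/-- The coefficientwise extension of a derivation to power series. -/
noncomputable def coeffDeriv {S R : Type*} [CommRing S] [CommRing R] [Algebra S R]
    (D : Derivation S R R) (f : PowerSeries R) : PowerSeries R :=
  PowerSeries.mk fun n => D (PowerSeries.coeff n f)

theorem coeffDeriv_mul {S R : Type*} [CommRing S] [CommRing R] [Algebra S R]
    (D : Derivation S R R) (f g : PowerSeries R) :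
    coeffDeriv D (f * g) = coeffDeriv D f * g + f * coeffDeriv D g := by
  ext n
  simp only [coeffDeriv, PowerSeries.coeff_mk, map_add, PowerSeries.coeff_mul, map_sum,
    Derivation.leibniz, smul_eq_mul, ← Finset.sum_add_distrib]
  refine Finset.sum_congr rfl fun p _ => ?_
  ring

theorem coeffDeriv_prod {S R : Type*} [CommRing S] [CommRing R] [Algebra S R]
    (D : Derivation S R R) (s : Finset ℕ) (e g : ℕ → PowerSeries R)
    (h : ∀ i ∈ s, coeffDeriv D (e i) = e i * g i) :
    coeffDeriv D (∏ i ∈ s, e i) = (∏ i ∈ s, e i) * ∑ i ∈ s, g i := by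
  classical
  induction s using Finset.induction_on with
  | empty =>
    ext n
    simp only [coeffDeriv, Finset.prod_empty, Finset.sum_empty, mul_zero, PowerSeries.coeff_mk,
      PowerSeries.coeff_one, map_zero]
    split_ifs <;> simp
  | insert a s ha ih =>
    rw [Finset.prod_insert ha, Finset.sum_insert ha, coeffDeriv_mul,
      ih fun i hi => h i (Finset.mem_insert_of_mem hi), h a (Finset.mem_insert_self _ _)]
    ring

/-- The sum over the partitions of `n` of the products of `f p r` over the parts `p` with
multiplicity `r`. -/
noncomputable def partitionSum {R : Type*} [CommRing R] (f : ℕ → ℕ → R) (n : ℕ) : R :=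
  ∑ lam : Nat.Partition n, ∏ p ∈ lam.parts.toFinset, f p (lam.parts.count p)

theorem eventually_coeff_prod_eq_partitionSum {R : Type*} [CommRing R] (f : ℕ → ℕ → R)
    (hf : ∀ i, f i 0 = 1) (n : ℕ) :
    ∀ᶠ s : Finset ℕ in Filter.atTop, PowerSeries.coeff n
      (∏ i ∈ s, dilate (i + 1) (PowerSeries.mk (f (i + 1)))) = partitionSum f n := by
  let _ : TopologicalSpace R := ⊥
  have : DiscreteTopology R := ⟨rfl⟩
  open scoped PowerSeries.WithPiTopology in
  have h := Nat.Partition.hasProd_genFun f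
  open scoped PowerSeries.WithPiTopology in
  have hE : ∀ i, (1 : PowerSeries R) + ∑' j, f (i + 1) (j + 1) •
      (PowerSeries.X : PowerSeries R) ^ ((i + 1) * (j + 1)) =
      dilate (i + 1) (PowerSeries.mk (f (i + 1))) := by
    intro i
    ext k
    rw [map_add, (Nat.Partition.summable_genFun_term f i).map_tsum _
      (PowerSeries.WithPiTopology.continuous_coeff _ _), coeff_dilate, PowerSeries.coeff_mk]
    simp only [PowerSeries.coeff_smul, PowerSeries.coeff_X_pow, smul_eq_mul, mul_ite, mul_one,
      mul_zero, PowerSeries.coeff_one]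
    rcases Nat.eq_zero_or_pos k with rfl | hk
    · simp [hf]
    rw [if_neg hk.ne', zero_add]
    by_cases hd : i + 1 ∣ k
    · obtain ⟨j, rfl⟩ := hd
      have hj : j ≠ 0 := by rintro rfl; simp at hk
      obtain ⟨j, rfl⟩ := Nat.exists_eq_succ_of_ne_zero hj
      rw [tsum_eq_single j]
      · simp
      · intro b hb
        rw [if_neg]
        intro h
        exact hb (by simpa using (Nat.eq_of_mul_eq_mul_left (Nat.succ_pos i) h).symm)
    · rw [if_neg hd]
      convert tsum_zero with j
      rw [if_neg]
      rintro rfl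
      exact hd (dvd_mul_right _ _)
  simp only [hE] at h
  rw [HasProd, PowerSeries.WithPiTopology.tendsto_iff_coeff_tendsto] at h
  have h2 := h n
  rw [nhds_discrete, Filter.tendsto_pure] at h2
  refine h2.mono fun s hs => ?_
  rw [hs, Nat.Partition.coeff_genFun, partitionSum]
  refine Finset.sum_congr rfl fun p _ => ?_
  simp [Finsupp.prod]

/-- Logarithmic derivative of a product over all parts, at the level of partition sums. -/
theorem deriv_partitionSum {S R : Type*} [CommRing S] [CommRing R] [Algebra S R]
    (D : Derivation S R R) (f g : ℕ → ℕ → R) (hf : ∀ i, f i 0 = 1) (hg : ∀ i, g i 0 = 0)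
    (h : ∀ i ≠ 0, ∀ r, D (f i r) = ∑ p ∈ Finset.HasAntidiagonal.antidiagonal r, f i p.1 * g i p.2)
    (n : ℕ) :
    D (partitionSum f n) = ∑ p ∈ Finset.HasAntidiagonal.antidiagonal n,
      partitionSum f p.1 * ∑ i ∈ p.2.divisors, g i (p.2 / i) := by
  have hev : ∀ᶠ s : Finset ℕ in Filter.atTop, (∀ a ∈ Finset.range (n + 1), PowerSeries.coeff a
      (∏ i ∈ s, dilate (i + 1) (PowerSeries.mk (f (i + 1)))) = partitionSum f a) ∧
      Finset.range n ⊆ s :=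
    ((Filter.eventually_all_finset _).2 fun a _ =>
      eventually_coeff_prod_eq_partitionSum f hf a).and (Filter.eventually_ge_atTop _)
  obtain ⟨s, hs, hsub⟩ := hev.exists
  have key := coeffDeriv_prod D s (fun i => dilate (i + 1) (PowerSeries.mk (f (i + 1))))
    (fun i => dilate (i + 1) (PowerSeries.mk (g (i + 1)))) (by
      intro i _
      have : coeffDeriv D (dilate (i + 1) (PowerSeries.mk (f (i + 1)))) =
          dilate (i + 1) (PowerSeries.mk (f (i + 1)) * PowerSeries.mk (g (i + 1))) := by
        ext k
        simp only [coeffDeriv, coeff_dilate, PowerSeries.coeff_mk, PowerSeries.coeff_mul]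
        split_ifs
        · exact h _ (Nat.succ_ne_zero i) _
        · simp
      rw [this]
      simp only [dilate_eq_expand (Nat.succ_ne_zero i), map_mul])
  have key2 := congrArg (PowerSeries.coeff n) key
  rw [coeffDeriv, PowerSeries.coeff_mk, hs n (by simp), PowerSeries.coeff_mul] at key2
  rw [key2]
  refine Finset.sum_congr rfl fun p hp => ?_
  have hp' := Finset.HasAntidiagonal.mem_antidiagonal.1 hp
  rw [hs p.1 (by simp; omega)]
  congr 1
  rw [map_sum]
  simp only [coeff_dilate, PowerSeries.coeff_mk]
  rcases Nat.eq_zero_or_pos p.2 with h0 | h0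
  · simp [h0, hg]
  rw [← Finset.sum_filter]
  refine Finset.sum_bij (fun i _ => i + 1) ?_ ?_ ?_ ?_
  · intro i hi
    simp only [Finset.mem_filter] at hi
    exact Nat.mem_divisors.2 ⟨hi.2, h0.ne'⟩
  · intro a _ b _ hab
    omega
  · intro b hb
    have hb1 := Nat.pos_of_mem_divisors hb
    have hb2 := Nat.divisor_le hb
    refine ⟨b - 1, ?_, by omega⟩
    simp only [Finset.mem_filter]
    refine ⟨hsub (by simp; omega), ?_⟩
    rw [Nat.sub_add_cancel hb1]
    exact Nat.dvd_of_mem_divisors hb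
  · intro i _
    rfl

/-- The Euler derivation `t ∂/∂t` of `ℚ[m][t]`. -/
noncomputable def eulerDeriv : Derivation (Polynomial ℚ) Qmt Qmt :=
  (Polynomial.X : Qmt) • Polynomial.derivative'

theorem eulerDeriv_apply (f : Qmt) : eulerDeriv f = Polynomial.X * Polynomial.derivative f := rfl

theorem coeff_eulerDeriv (f : Qmt) (k : ℕ) :
    (eulerDeriv f).coeff k = (k : Polynomial ℚ) * f.coeff k := by
  rw [eulerDeriv_apply]
  cases k with
  | zero => simp
  | succ k =>
    rw [Polynomial.coeff_X_mul, Polynomial.coeff_derivative]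
    push_cast
    ring

theorem coeff_tPow {d : ℕ} (hd : d ≠ 0) (f : Qmt) (k : ℕ) :
    (tPow d f).coeff k = if d ∣ k then f.coeff (k / d) else 0 := by
  rw [tPow, ← Polynomial.expand_eq_comp_X_pow, Polynomial.coeff_expand (Nat.pos_of_ne_zero hd)]

theorem eulerDeriv_tPow {d : ℕ} (hd : d ≠ 0) (f : Qmt) :
    eulerDeriv (tPow d f) = (d : Qmt) * tPow d (eulerDeriv f) := by
  ext1 k
  rw [coeff_eulerDeriv, coeff_tPow hd, Polynomial.coeff_natCast_mul, coeff_tPow hd,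
    coeff_eulerDeriv]
  split_ifs with h
  · obtain ⟨j, rfl⟩ := h
    rw [Nat.mul_div_cancel_left _ (Nat.pos_of_ne_zero hd)]
    push_cast
    ring
  · simp

theorem partitionSum_zero {R : Type*} [CommRing R] (f : ℕ → ℕ → R) : partitionSum f 0 = 1 := by
  rw [partitionSum, Fintype.sum_unique]
  simp

theorem partitionSum_one {R : Type*} [CommRing R] (f : ℕ → ℕ → R) :
    partitionSum f 1 = f 1 1 := by
  rw [partitionSum, Fintype.sum_unique]
  simp

theorem plethH_eq_partitionSum (r : ℕ) (f : Qmt) :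
    plethH r f = partitionSum (fun d j => Polynomial.C (Polynomial.C
      (((d ^ j * j.factorial : ℕ) : ℚ)⁻¹)) * tPow d f ^ j) r := by
  rw [plethH, partitionSum]
  refine Finset.sum_congr rfl fun μ _ => ?_
  rw [Finset.prod_mul_distrib, tPowMul, Finset.prod_multiset_map_count, zPart]
  congr 1
  rw [Nat.cast_prod, ← Finset.prod_inv_distrib, map_prod, map_prod]

theorem sum_divisors_ite_div_eq_one {R : Type*} [AddCommMonoid R] (b : ℕ) (φ : ℕ → R) :
    ∑ i ∈ b.divisors, (if b / i = 1 then φ i else 0) = if b = 0 then 0 else φ b := by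
  rcases Nat.eq_zero_or_pos b with h0 | h0
  · simp [h0]
  rw [if_neg h0.ne', Finset.sum_eq_single_of_mem b (Nat.mem_divisors_self _ h0.ne')]
  · rw [if_pos (Nat.div_self h0)]
  · intro i hi hne
    rw [if_neg]
    intro h
    obtain ⟨c, hc⟩ := Nat.dvd_of_mem_divisors hi
    rw [hc, Nat.mul_div_cancel_left _ (Nat.pos_of_mem_divisors hi)] at h
    exact hne (by rw [hc, h, mul_one])

theorem eulerDeriv_plethH (r : ℕ) (f : Qmt) :
    eulerDeriv (plethH r f) = ∑ p ∈ Finset.HasAntidiagonal.antidiagonal r,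
      plethH p.1 f * if p.2 = 0 then 0 else tPow p.2 (eulerDeriv f) := by
  simp only [plethH_eq_partitionSum]
  rw [deriv_partitionSum eulerDeriv _ (fun d j => if j = 1 then tPow d (eulerDeriv f) else 0)]
  · refine Finset.sum_congr rfl fun p _ => ?_
    congr 1
    exact sum_divisors_ite_div_eq_one p.2 fun i => tPow i (eulerDeriv f)
  · intro i
    simp
  · intro i
    simp
  · intro i hi r
    cases r with
    | zero => simp
    | succ j =>
      rw [Finset.sum_eq_single_of_mem (j, 1) (by simp)]
      · rw [if_pos rfl, Derivation.leibniz, Derivation.leibniz_pow, eulerDeriv_tPow hi]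
        have hC : eulerDeriv (Polynomial.C (Polynomial.C
            (((i ^ (j + 1) * (j + 1).factorial : ℕ) : ℚ)⁻¹)) : Qmt) = 0 := by
          simp
        rw [hC, smul_zero, add_zero]
        have hcast : (Polynomial.C (Polynomial.C (((i ^ j * j.factorial : ℕ) : ℚ)⁻¹)) : Qmt) =
            Polynomial.C (Polynomial.C (((i ^ (j + 1) * (j + 1).factorial : ℕ) : ℚ)⁻¹)) *
              ((i : Qmt) * ((j + 1 : ℕ) : Qmt)) := by
          have e1 : (i : Qmt) = Polynomial.C (Polynomial.C (i : ℚ)) := by simp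
          have e2 : ((j + 1 : ℕ) : Qmt) = Polynomial.C (Polynomial.C ((j + 1 : ℕ) : ℚ)) := by
            simp
          rw [e1, e2, ← map_mul, ← map_mul, ← map_mul, ← map_mul]
          congr 2
          have h1 : (i : ℚ) ≠ 0 := Nat.cast_ne_zero.2 hi
          have h2 : (j.factorial : ℚ) ≠ 0 := Nat.cast_ne_zero.2 (Nat.factorial_ne_zero j)
          have h3 : (j : ℚ) + 1 ≠ 0 := by positivity
          push_cast [Nat.factorial_succ, pow_succ]
          field_simp
        rw [hcast, Nat.add_sub_cancel]
        simp only [smul_eq_mul, nsmul_eq_mul]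
        ring
      · rintro ⟨a, b⟩ hab hne
        rw [if_neg, mul_zero]
        rintro rfl
        simp at hab
        exact hne (by simp [hab])

theorem plethH_zero (f : Qmt) : plethH 0 f = 1 := by
  rw [plethH_eq_partitionSum, partitionSum_zero]

theorem tPow_one (f : Qmt) : tPow 1 f = f := by simp [tPow]

theorem plethH_one (f : Qmt) : plethH 1 f = f := by
  rw [plethH_eq_partitionSum, partitionSum_one]
  simp [tPow_one]

/-- The degree `n` part of the plethystic exponential of the sequence `F`. -/
noncomputable def plethExp (F : ℕ → Qmt) (n : ℕ) : Qmt :=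
  partitionSum (fun i r => plethH r (F i)) n

theorem eulerDeriv_plethExp (F : ℕ → Qmt) (n : ℕ) :
    eulerDeriv (plethExp F n) = ∑ p ∈ Finset.HasAntidiagonal.antidiagonal n,
      plethExp F p.1 * ∑ i ∈ p.2.divisors, tPow (p.2 / i) (eulerDeriv (F i)) := by
  unfold plethExp
  rw [deriv_partitionSum eulerDeriv _ (fun i j => if j = 0 then 0 else tPow j (eulerDeriv (F i)))]
  · refine Finset.sum_congr rfl fun p _ => ?_
    congr 1
    refine Finset.sum_congr rfl fun i hi => ?_
    rw [if_neg]
    exact (Nat.div_pos (Nat.divisor_le hi) (Nat.pos_of_mem_divisors hi)).ne'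
  · intro i
    exact plethH_zero _
  · intro i
    simp
  · intro i _ r
    exact eulerDeriv_plethH r (F i)

theorem Qfull_eq_plethExp (n : ℕ) : Qfull n = plethExp Qplus n := by
  rw [Qfull]
  split_ifs with h
  · subst h
    rw [plethExp, partitionSum_one, plethH_one, Qplus, Nat.strongRecOn_eq, if_pos rfl]
  · rfl

theorem Qplus_one : Qplus 1 = mPoly := by
  rw [Qplus, Nat.strongRecOn_eq, if_pos rfl]

theorem Qplus_eq {n : ℕ} (hn : n ≠ 1) : Qplus n = ∑ lam : Nat.Partition n,
    (∑ i ∈ Finset.Icc 1 (Multiset.card lam.parts - 2), (Polynomial.X : Qmt) ^ i) *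
      ∏ p ∈ lam.parts.toFinset, plethH (lam.parts.count p) (Qplus p) := by
  conv_lhs => rw [Qplus, Nat.strongRecOn_eq, if_neg hn]
  refine Finset.sum_congr rfl fun lam _ => ?_
  by_cases hc : Multiset.card lam.parts ≤ 2
  · rw [Nat.sub_eq_zero_of_le hc]
    simp
  · congr 1
    refine Finset.prod_congr rfl fun p hp => ?_
    have hp' := Multiset.mem_toFinset.1 hp
    have hlt : p < n := by
      obtain ⟨s, hs⟩ := Multiset.exists_cons_of_mem hp'
      have hsum := lam.parts_sum
      rw [hs, Multiset.sum_cons] at hsum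
      have hs0 : s ≠ 0 := by
        rintro rfl
        simp [hs] at hc
      obtain ⟨q, hq⟩ := Multiset.exists_mem_of_ne_zero hs0
      have hq0 : 0 < q := lam.parts_pos (by rw [hs]; exact Multiset.mem_cons_of_mem hq)
      have := Multiset.single_le_sum (fun x _ => Nat.zero_le x) q hq
      omega
    rw [dif_pos hlt]
    rfl

theorem Qplus_zero : Qplus 0 = 0 := by
  rw [Qplus_eq zero_ne_one]
  refine Finset.sum_eq_zero fun lam _ => ?_
  rw [Nat.Partition.partition_zero_parts]
  simp

theorem tPow_mul (d : ℕ) (f g : Qmt) : tPow d (f * g) = tPow d f * tPow d g := by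
  simp [tPow]

theorem plethH_X_mul (r : ℕ) (f : Qmt) :
    plethH r (Polynomial.X * f) = Polynomial.X ^ r * plethH r f := by
  rw [plethH, plethH, Finset.mul_sum]
  refine Finset.sum_congr rfl fun μ _ => ?_
  have : tPowMul μ.parts (Polynomial.X * f) = Polynomial.X ^ r * tPowMul μ.parts f := by
    have hX : ∀ d, tPow d (Polynomial.X : Qmt) = Polynomial.X ^ d := fun d => by simp [tPow]
    simp only [tPowMul, tPow_mul, Multiset.prod_map_mul, hX]
    congr 1
    have hpow : ∀ s : Multiset ℕ, (s.map fun d => (Polynomial.X : Qmt) ^ d).prod =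
        Polynomial.X ^ s.sum := fun s => by
      induction s using Multiset.induction_on with
      | empty => simp
      | cons a s ih => simp [ih, pow_add]
    exact (hpow _).trans (by rw [μ.parts_sum])
  rw [this]
  ring

theorem plethExp_X_mul (F : ℕ → Qmt) (n : ℕ) :
    plethExp (fun i => Polynomial.X * F i) n = ∑ lam : Nat.Partition n,
      Polynomial.X ^ (Multiset.card lam.parts) *
        ∏ p ∈ lam.parts.toFinset, plethH (lam.parts.count p) (F p) := by
  rw [plethExp, partitionSum]
  refine Finset.sum_congr rfl fun lam _ => ?_
  simp only [plethH_X_mul]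
  rw [Finset.prod_mul_distrib, Finset.prod_pow_eq_pow_sum, Multiset.toFinset_sum_count_eq]

theorem parts_card_eq_one_iff {n : ℕ} (hn : n ≠ 0) (lam : Nat.Partition n) :
    Multiset.card lam.parts = 1 ↔ lam = Nat.Partition.indiscrete n := by
  constructor
  · intro h
    obtain ⟨a, ha⟩ := Multiset.card_eq_one.1 h
    have hs := lam.parts_sum
    rw [ha, Multiset.sum_singleton] at hs
    ext1
    rw [ha, hs, Nat.Partition.indiscrete_parts hn]
  · rintro rfl
    rw [Nat.Partition.indiscrete_parts hn, Multiset.card_singleton]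

theorem one_sub_mul_sum_Icc_pow (l : ℕ) (hl : 2 ≤ l) :
    Polynomial.X * (1 - Polynomial.X) * (∑ i ∈ Finset.Icc 1 (l - 2), (Polynomial.X : Qmt) ^ i) =
      Polynomial.X ^ 2 - Polynomial.X ^ l := by
  obtain ⟨l, rfl⟩ := Nat.exists_eq_add_of_le hl
  rw [Nat.add_sub_cancel_left]
  induction l with
  | zero => simp
  | succ l ih =>
    rw [Finset.sum_Icc_succ_top (by omega), mul_add, ih (by omega)]
    ring

/-- `Exp(t 𝒬⁺)` and `t² Exp(𝒬⁺)` agree in degrees at least two. -/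
theorem plethExp_X_mul_Qplus {n : ℕ} (hn : 2 ≤ n) :
    plethExp (fun i => Polynomial.X * Qplus i) n = Polynomial.X ^ 2 * Qfull n := by
  have hn0 : n ≠ 0 := by omega
  have hQ : (Polynomial.X : Qmt) * (1 - Polynomial.X) * Qplus n =
      ∑ lam : Nat.Partition n, (Polynomial.X ^ 2 - Polynomial.X ^ (Multiset.card lam.parts) +
        if lam = Nat.Partition.indiscrete n then (Polynomial.X : Qmt) * (1 - Polynomial.X) else 0) *
        ∏ p ∈ lam.parts.toFinset, plethH (lam.parts.count p) (Qplus p) := by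
    rw [Qplus_eq (by omega), Finset.mul_sum]
    refine Finset.sum_congr rfl fun lam _ => ?_
    rw [← mul_assoc]
    congr 1
    have hc0 : Multiset.card lam.parts ≠ 0 := by
      intro h
      have hs := lam.parts_sum
      rw [Multiset.card_eq_zero.1 h, Multiset.sum_zero] at hs
      omega
    split_ifs with h
    · rw [(parts_card_eq_one_iff hn0 lam).2 h]
      simp
      ring
    · rw [one_sub_mul_sum_Icc_pow, add_zero]
      have := mt (parts_card_eq_one_iff hn0 lam).1 h
      omega
  simp only [add_mul, sub_mul, Finset.sum_add_distrib, Finset.sum_sub_distrib, ite_mul, zero_mul,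
    Finset.sum_ite_eq', Finset.mem_univ, if_true, ← Finset.mul_sum] at hQ
  rw [Nat.Partition.indiscrete_parts hn0] at hQ
  simp only [Multiset.toFinset_singleton, Finset.prod_singleton, Multiset.count_singleton_self,
    plethH_one] at hQ
  rw [plethExp_X_mul, Qfull_eq_plethExp]
  unfold plethExp partitionSum
  linear_combination hQ

/-- The Euler identity in the degree variable for partition sums. -/
theorem natCast_mul_partitionSum (f g : ℕ → ℕ → ℚ) (hf : ∀ i, f i 0 = 1) (hg : ∀ i, g i 0 = 0)
    (h : ∀ i ≠ 0, ∀ r, ((i * r : ℕ) : ℚ) * f i r =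
      ∑ p ∈ Finset.HasAntidiagonal.antidiagonal r, f i p.1 * g i p.2)
    (n : ℕ) :
    (n : ℚ) * partitionSum f n = ∑ p ∈ Finset.HasAntidiagonal.antidiagonal n,
      partitionSum f p.1 * ∑ i ∈ p.2.divisors, g i (p.2 / i) := by
  set D : Derivation ℚ ℚ[X] ℚ[X] := (Polynomial.X : ℚ[X]) • Polynomial.derivative' with hD
  have hDm : ∀ (c : ℚ) (k : ℕ), D (Polynomial.C c * Polynomial.X ^ k) =
      Polynomial.C ((k : ℚ) * c) * Polynomial.X ^ k := by
    intro c k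
    have e : D (Polynomial.C c * Polynomial.X ^ k) =
      Polynomial.X * Polynomial.derivative (Polynomial.C c * Polynomial.X ^ k) := rfl
    rw [e]
    cases k with
    | zero => simp
    | succ k =>
      rw [Polynomial.derivative_C_mul_X_pow, Nat.add_sub_cancel, mul_comm c]
      ring
  have key : ∀ n, partitionSum (fun i r => Polynomial.C (f i r) * (Polynomial.X : ℚ[X]) ^ (i * r)) n
      = Polynomial.C (partitionSum f n) * Polynomial.X ^ n := by
    intro n
    rw [partitionSum, partitionSum, map_sum, Finset.sum_mul]
    refine Finset.sum_congr rfl fun lam _ => ?_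
    rw [Finset.prod_mul_distrib, map_prod, Finset.prod_pow_eq_pow_sum]
    congr 2
    conv_rhs => rw [← lam.parts_sum, Finset.sum_multiset_count]
    refine Finset.sum_congr rfl fun p _ => ?_
    rw [smul_eq_mul, mul_comm]
  have main := deriv_partitionSum D
    (fun i r => Polynomial.C (f i r) * (Polynomial.X : ℚ[X]) ^ (i * r))
    (fun i r => Polynomial.C (g i r) * (Polynomial.X : ℚ[X]) ^ (i * r))
    (by intro i; simp [hf]) (by intro i; simp [hg]) (by
      intro i hi r
      rw [hDm, h i hi, map_sum, Finset.sum_mul]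
      refine Finset.sum_congr rfl fun p hp => ?_
      rw [← Finset.HasAntidiagonal.mem_antidiagonal.1 hp, map_mul]
      ring) n
  rw [key, hDm] at main
  have main2 := congrArg (Polynomial.eval 1) main
  simp only [key, Polynomial.eval_mul, Polynomial.eval_C, Polynomial.eval_pow, Polynomial.eval_X,
    one_pow, mul_one, Polynomial.eval_finsetSum] at main2
  exact main2

theorem eq_coeff_mk_one_pow (m : ℕ) (y : ℕ → ℚ) (h0 : y 0 = 1)
    (h : ∀ n : ℕ, (n : ℚ) * y n = ∑ p ∈ Finset.HasAntidiagonal.antidiagonal n,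
      y p.1 * if p.2 = 0 then 0 else (m : ℚ)) :
    PowerSeries.mk y = (PowerSeries.mk 1 : PowerSeries ℚ) ^ m := by
  have hsum : ∀ n : ℕ, ((n + 1 : ℕ) : ℚ) * y (n + 1) =
      (m : ℚ) * ∑ a ∈ Finset.range (n + 1), y a := by
    intro n
    rw [h, Finset.Nat.sum_antidiagonal_succ', Finset.Nat.sum_antidiagonal_eq_sum_range_succ_mk,
      Finset.mul_sum]
    simp only [if_true, mul_zero, zero_add, Nat.succ_ne_zero, if_false]
    refine Finset.sum_congr rfl fun a _ => mul_comm _ _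
  have hrec : ∀ n : ℕ, ((n + 1 : ℕ) : ℚ) * y (n + 1) = ((m : ℚ) + n) * y n := by
    intro n
    rw [hsum, Finset.sum_range_succ, mul_add]
    cases n with
    | zero => simp
    | succ n =>
      rw [← hsum]
      ring
  cases m with
  | zero =>
    ext n
    rw [PowerSeries.coeff_mk, pow_zero, PowerSeries.coeff_one]
    cases n with
    | zero => simpa using h0
    | succ n =>
      have := hsum n
      simp only [Nat.cast_zero, zero_mul] at this
      rw [if_neg (Nat.succ_ne_zero n)]
      exact (mul_eq_zero.1 this).resolve_left (by positivity)
  | succ m =>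
    rw [PowerSeries.mk_one_pow_eq_mk_choose_add]
    congr 1
    funext n
    induction n with
    | zero => simpa using h0
    | succ n ih =>
      have h1 := hrec n
      rw [ih] at h1
      have h2 : ((m + n + 1).choose m : ℚ) * ((n + 1 : ℕ) : ℚ) =
          ((m + n).choose m : ℚ) * ((m + n + 1 : ℕ) : ℚ) := by
        have := Nat.choose_mul_succ_eq (m + n) m
        rw [show m + n + 1 - m = n + 1 by omega] at this
        exact_mod_cast this.symm
      have h3 : ((n + 1 : ℕ) : ℚ) ≠ 0 := by positivity
      apply mul_left_cancel₀ h3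
      rw [h1, ← add_assoc]
      push_cast at h2 ⊢
      linear_combination -h2

/-- The power series in `x` whose `n`-th coefficient is the value at `m₀` of the coefficient of
`t^k` in `F n`. -/
noncomputable def coeffSeries (m₀ : ℕ) (F : ℕ → Qmt) (k : ℕ) : PowerSeries ℚ :=
  PowerSeries.mk fun n => ((F n).coeff k).eval (m₀ : ℚ)

theorem coeff_coeffSeries (m₀ : ℕ) (F : ℕ → Qmt) (k n : ℕ) :
    PowerSeries.coeff n (coeffSeries m₀ F k) = ((F n).coeff k).eval (m₀ : ℚ) := by
  simp [coeffSeries]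

theorem sum_divisors_eval_coeff_tPow (m₀ : ℕ) (F : ℕ → Qmt) (hF : F 0 = 0) (j b : ℕ) :
    ((∑ i ∈ b.divisors, tPow (b / i) (eulerDeriv (F i))).coeff j).eval (m₀ : ℚ) =
      PowerSeries.coeff b (∑ d ∈ j.divisors,
        (((j / d : ℕ) : ℚ)) • dilate d (coeffSeries m₀ F (j / d))) := by
  have hL : ((∑ i ∈ b.divisors, tPow (b / i) (eulerDeriv (F i))).coeff j).eval (m₀ : ℚ) =
      ∑ d ∈ b.divisors, if d ∣ j then
        ((j / d : ℕ) : ℚ) * ((F (b / d)).coeff (j / d)).eval (m₀ : ℚ) else 0 := by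
    rw [← Nat.sum_div_divisors, Polynomial.finsetSum_coeff, Polynomial.eval_finsetSum]
    refine Finset.sum_congr rfl fun d hd => ?_
    rw [Nat.div_div_self (Nat.dvd_of_mem_divisors hd) (Nat.ne_zero_of_mem_divisors hd),
      coeff_tPow (Nat.pos_of_mem_divisors hd).ne']
    split_ifs
    · simp [coeff_eulerDeriv]
    · simp
  rw [hL, map_sum]
  simp only [map_smul, coeff_dilate, coeff_coeffSeries, smul_eq_mul, mul_ite, mul_zero]
  rcases Nat.eq_zero_or_pos b with rfl | hb
  · simp [hF]
  rcases Nat.eq_zero_or_pos j with rfl | hj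
  · simp
  rw [← Finset.sum_filter, ← Finset.sum_filter]
  refine Finset.sum_congr ?_ fun _ _ => rfl
  ext d
  simp only [Finset.mem_filter, Nat.mem_divisors]
  constructor
  · rintro ⟨⟨h1, _⟩, h2⟩
    exact ⟨⟨h2, hj.ne'⟩, h1⟩
  · rintro ⟨⟨h1, _⟩, h2⟩
    exact ⟨⟨h2, hb.ne'⟩, h1⟩

theorem coeffSeries_plethExp (m₀ : ℕ) (F : ℕ → Qmt) (hF : F 0 = 0) (k : ℕ) :
    (k : ℚ) • coeffSeries m₀ (plethExp F) k = ∑ p ∈ Finset.HasAntidiagonal.antidiagonal k,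
      coeffSeries m₀ (plethExp F) p.1 * ∑ d ∈ p.2.divisors,
        (((p.2 / d : ℕ) : ℚ)) • dilate d (coeffSeries m₀ F (p.2 / d)) := by
  ext n
  have h := congrArg (fun f : Qmt => (f.coeff k).eval (m₀ : ℚ)) (eulerDeriv_plethExp F n)
  simp only [coeff_eulerDeriv, Polynomial.eval_mul, Polynomial.eval_natCast,
    Polynomial.finsetSum_coeff, Polynomial.eval_finsetSum, Polynomial.coeff_mul] at h
  rw [map_smul, coeff_coeffSeries, smul_eq_mul, h, map_sum]
  simp only [PowerSeries.coeff_mul, coeff_coeffSeries]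
  rw [Finset.sum_comm]
  refine Finset.sum_congr rfl fun p _ => Finset.sum_congr rfl fun q _ => ?_
  rw [← sum_divisors_eval_coeff_tPow m₀ F hF, Polynomial.finsetSum_coeff,
    Polynomial.eval_finsetSum]

theorem natCast_mul_partitionSum_pow (a : ℚ) (n : ℕ) :
    (n : ℚ) * partitionSum (fun d j => (((d ^ j * j.factorial : ℕ) : ℚ)⁻¹) * a ^ j) n =
      ∑ p ∈ Finset.HasAntidiagonal.antidiagonal n,
        partitionSum (fun d j => (((d ^ j * j.factorial : ℕ) : ℚ)⁻¹) * a ^ j) p.1 *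
          if p.2 = 0 then 0 else a := by
  rw [natCast_mul_partitionSum _ (fun d j => if j = 1 then a else 0)]
  · refine Finset.sum_congr rfl fun p _ => ?_
    congr 1
    exact sum_divisors_ite_div_eq_one p.2 fun _ => a
  · intro i
    simp
  · intro i
    simp
  · intro i hi r
    cases r with
    | zero => simp
    | succ j =>
      rw [Finset.sum_eq_single_of_mem (j, 1) (by simp)]
      · have h1 : (i : ℚ) ≠ 0 := Nat.cast_ne_zero.2 hi
        have h2 : (j.factorial : ℚ) ≠ 0 := Nat.cast_ne_zero.2 (Nat.factorial_ne_zero j)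
        have h3 : (j : ℚ) + 1 ≠ 0 := by positivity
        rw [if_pos rfl]
        push_cast [Nat.factorial_succ, pow_succ]
        field_simp
      · rintro ⟨a, b⟩ hab hne
        rw [if_neg, mul_zero]
        rintro rfl
        simp at hab
        exact hne (by simp [hab])

theorem coeffSeries_Qfull_zero (m₀ : ℕ) :
    coeffSeries m₀ Qfull 0 = (PowerSeries.mk 1 : PowerSeries ℚ) ^ m₀ := by
  set ε : Qmt →+* ℚ := (Polynomial.evalRingHom (m₀ : ℚ)).comp Polynomial.constantCoeff with hε
  have hεa : ∀ f : Qmt, ε f = (f.coeff 0).eval (m₀ : ℚ) := fun f => rfl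
  set h : ℚ → ℕ → ℚ := fun a n =>
    partitionSum (fun d j => (((d ^ j * j.factorial : ℕ) : ℚ)⁻¹) * a ^ j) n with hh
  have hεh : ∀ r f, ε (plethH r f) = h (ε f) r := by
    intro r f
    rw [plethH_eq_partitionSum, hh]
    simp only [partitionSum, map_sum, map_prod, map_mul, map_pow]
    refine Finset.sum_congr rfl fun lam _ => Finset.prod_congr rfl fun p hp => ?_
    have hp0 : p ≠ 0 := (lam.parts_pos (Multiset.mem_toFinset.1 hp)).ne'
    congr 2
    · simp [hεa]
    · rw [hεa, hεa, coeff_tPow hp0, if_pos (dvd_zero p), Nat.zero_div]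
  have hεQ : ∀ i ≠ 1, ε (Qplus i) = 0 := by
    intro i hi
    rw [Qplus_eq hi, map_sum]
    refine Finset.sum_eq_zero fun lam _ => ?_
    rw [map_mul, map_sum, Finset.sum_eq_zero, zero_mul]
    intro j hj
    rw [Finset.mem_Icc] at hj
    rw [map_pow, hεa, Polynomial.coeff_X_zero, Polynomial.eval_zero, zero_pow (by omega)]
  have hεQ1 : ε (Qplus 1) = m₀ := by
    rw [Qplus_one, hεa, mPoly]
    simp
  have hy : ∀ n, ε (Qfull n) = partitionSum (fun i r => h (ε (Qplus i)) r) n := by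
    intro n
    rw [Qfull_eq_plethExp, plethExp]
    simp only [partitionSum, map_sum, map_prod, hεh]
  have hmk : coeffSeries m₀ Qfull 0 = PowerSeries.mk (fun n => ε (Qfull n)) := rfl
  rw [hmk]
  apply eq_coeff_mk_one_pow
  · rw [hy, partitionSum_zero]
  · intro n
    simp only [hy]
    rw [natCast_mul_partitionSum _ (fun i j => if j = 0 then 0 else (i : ℚ) * ε (Qplus i))]
    · refine Finset.sum_congr rfl fun p _ => ?_
      congr 1
      rcases Nat.eq_zero_or_pos p.2 with h0 | h0
      · simp [h0]
      · rw [if_neg h0.ne', Finset.sum_eq_single_of_mem 1 (Nat.one_mem_divisors.2 h0.ne')]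
        · simp [h0.ne', hεQ1]
        · intro b _ hb
          simp [hεQ b hb]
    · intro i
      exact partitionSum_zero _
    · intro i
      simp
    · intro i _ r
      have := natCast_mul_partitionSum_pow (ε (Qplus i)) r
      push_cast
      rw [mul_assoc, hh]
      simp only
      rw [this, Finset.mul_sum]
      refine Finset.sum_congr rfl fun p _ => ?_
      split_ifs
      · simp
      · ring

theorem coeffSeries_X_mul_succ (m₀ : ℕ) (F : ℕ → Qmt) (k : ℕ) :
    coeffSeries m₀ (fun i => Polynomial.X * F i) (k + 1) = coeffSeries m₀ F k := by
  ext n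
  simp [coeff_coeffSeries, Polynomial.coeff_X_mul]

theorem plethExp_zero (F : ℕ → Qmt) : plethExp F 0 = 1 := partitionSum_zero _

theorem plethExp_one (F : ℕ → Qmt) : plethExp F 1 = F 1 := by
  rw [plethExp, partitionSum_one, plethH_one]

theorem coeffSeries_plethExp_X_mul_zero (m₀ : ℕ) :
    coeffSeries m₀ (plethExp fun i => Polynomial.X * Qplus i) 0 = 1 := by
  ext n
  rw [coeff_coeffSeries, PowerSeries.coeff_one]
  match n with
  | 0 => simp [plethExp_zero]
  | 1 => simp [plethExp_one]
  | n + 2 => simp [plethExp_X_mul_Qplus]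

theorem coeffSeries_plethExp_X_mul_one (m₀ : ℕ) :
    coeffSeries m₀ (plethExp fun i => Polynomial.X * Qplus i) 1 =
      (m₀ : ℚ) • PowerSeries.X := by
  ext n
  rw [coeff_coeffSeries, PowerSeries.coeff_smul, PowerSeries.coeff_X]
  match n with
  | 0 => simp [plethExp_zero, Polynomial.coeff_one]
  | 1 => simp [plethExp_one, Qplus_one, mPoly]
  | n + 2 => simp [plethExp_X_mul_Qplus, Polynomial.coeff_X_pow_mul']

theorem coeffSeries_plethExp_X_mul_add_two (m₀ k : ℕ) :
    coeffSeries m₀ (plethExp fun i => Polynomial.X * Qplus i) (k + 2) =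
      coeffSeries m₀ Qfull k - if k = 0 then 1 + (m₀ : ℚ) • PowerSeries.X else 0 := by
  ext n
  rw [coeff_coeffSeries, map_sub, coeff_coeffSeries]
  match n with
  | 0 =>
    rw [Qfull_eq_plethExp, plethExp_zero, plethExp_zero, Polynomial.coeff_one, Polynomial.coeff_one]
    split_ifs <;> simp_all
  | 1 =>
    rw [Qfull_eq_plethExp, plethExp_one, plethExp_one, Qplus_one, mPoly, Polynomial.coeff_X_mul,
      Polynomial.coeff_C, Polynomial.coeff_C]
    split_ifs <;> simp_all [PowerSeries.coeff_one]
  | n + 2 =>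
    rw [plethExp_X_mul_Qplus (by omega), Polynomial.coeff_X_pow_mul]
    split_ifs <;> simp [PowerSeries.coeff_X, PowerSeries.coeff_one]

/-- The degree `k` coefficient of `Σ_d (t ∂_t F)(x^d, t^d)` for `F = Σ F_k t^k`. -/
noncomputable def dilateSum (F : ℕ → PowerSeries ℚ) (j : ℕ) : PowerSeries ℚ :=
  ∑ d ∈ j.divisors, (((j / d : ℕ) : ℚ)) • dilate d (F (j / d))

theorem coeffSeries_Qfull_rec (m₀ k : ℕ) :
    (k : ℚ) • coeffSeries m₀ Qfull k = ∑ p ∈ Finset.HasAntidiagonal.antidiagonal k,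
      coeffSeries m₀ Qfull p.1 * dilateSum (coeffSeries m₀ Qplus) p.2 := by
  rw [show Qfull = plethExp Qplus from funext Qfull_eq_plethExp]
  exact coeffSeries_plethExp m₀ Qplus Qplus_zero k

theorem coeffSeries_plethExp_X_mul_rec (m₀ k : ℕ) :
    (k : ℚ) • coeffSeries m₀ (plethExp fun i => Polynomial.X * Qplus i) k =
      ∑ p ∈ Finset.HasAntidiagonal.antidiagonal k,
        coeffSeries m₀ (plethExp fun i => Polynomial.X * Qplus i) p.1 *
          dilateSum (fun j => coeffSeries m₀ Qplus (j - 1)) p.2 := by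
  rw [coeffSeries_plethExp m₀ _ (by simp [Qplus_zero])]
  refine Finset.sum_congr rfl fun p _ => ?_
  congr 1
  refine Finset.sum_congr rfl fun d hd => ?_
  have : p.2 / d ≠ 0 :=
    (Nat.div_pos (Nat.divisor_le hd) (Nat.pos_of_mem_divisors hd)).ne'
  obtain ⟨j, hj⟩ := Nat.exists_eq_succ_of_ne_zero this
  rw [hj, Nat.succ_eq_add_one, coeffSeries_X_mul_succ]
  rfl

theorem dilateSum_zero (F : ℕ → PowerSeries ℚ) : dilateSum F 0 = 0 := by simp [dilateSum]

theorem dilate_one {R : Type*} [CommRing R] (f : PowerSeries R) : dilate 1 f = f := by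
  ext n
  simp [coeff_dilate]

theorem dilateSum_one (F : ℕ → PowerSeries ℚ) : dilateSum F 1 = F 1 := by
  simp [dilateSum, dilate_one]

theorem coeffSeries_Qplus_zero (m₀ : ℕ) :
    coeffSeries m₀ Qplus 0 = (m₀ : ℚ) • PowerSeries.X := by
  have h := coeffSeries_plethExp_X_mul_rec m₀ 1
  rw [Finset.Nat.sum_antidiagonal_succ, coeffSeries_plethExp_X_mul_one,
    coeffSeries_plethExp_X_mul_zero] at h
  simp [dilateSum_zero, dilateSum_one] at h
  exact h.symm

/-- Coefficientwise majorization of power series. -/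
def MajorizedBy (f g : PowerSeries ℚ) : Prop :=
  ∀ n, |PowerSeries.coeff n f| ≤ PowerSeries.coeff n g

theorem MajorizedBy.nonneg {f g : PowerSeries ℚ} (h : MajorizedBy f g) (n : ℕ) :
    0 ≤ PowerSeries.coeff n g :=
  (abs_nonneg _).trans (h n)

theorem MajorizedBy.add {f g f' g' : PowerSeries ℚ} (h : MajorizedBy f g)
    (h' : MajorizedBy f' g') : MajorizedBy (f + f') (g + g') := fun n => by
  rw [map_add, map_add]
  exact (abs_add_le _ _).trans (add_le_add (h n) (h' n))

theorem MajorizedBy.mul {f g f' g' : PowerSeries ℚ} (h : MajorizedBy f g)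
    (h' : MajorizedBy f' g') : MajorizedBy (f * f') (g * g') := fun n => by
  rw [PowerSeries.coeff_mul, PowerSeries.coeff_mul]
  refine (Finset.abs_sum_le_sum_abs _ _).trans (Finset.sum_le_sum fun p _ => ?_)
  rw [abs_mul]
  exact mul_le_mul (h _) (h' _) (abs_nonneg _) (h.nonneg _)

theorem MajorizedBy.trans {f g k : PowerSeries ℚ} (h : MajorizedBy f g) (h' : MajorizedBy g k) :
    MajorizedBy f k := fun n => (h n).trans ((le_abs_self _).trans (h' n))

theorem MajorizedBy.refl_of_nonneg {f : PowerSeries ℚ} (h : ∀ n, 0 ≤ PowerSeries.coeff n f) :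
    MajorizedBy f f := fun n => (abs_of_nonneg (h n)).le

/-- The geometric series `1 / (1 - x)`. -/
noncomputable abbrev geomSeries : PowerSeries ℚ := PowerSeries.mk 1

theorem one_majorizedBy_geomSeries : MajorizedBy 1 geomSeries := fun n => by
  rw [PowerSeries.coeff_one, PowerSeries.coeff_mk]
  split_ifs <;> simp

theorem MajorizedBy.pow {f g : PowerSeries ℚ} (h : MajorizedBy f g) (r : ℕ) :
    MajorizedBy (f ^ r) (g ^ r) := by
  induction r with
  | zero =>
    intro n
    rw [pow_zero, pow_zero, PowerSeries.coeff_one]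
    split_ifs <;> simp
  | succ r ih =>
    rw [pow_succ, pow_succ]
    exact ih.mul h

/-- `f` is coefficientwise dominated by a polynomial times `1 / (1 - x)^s`. -/
def PoleOrderLE (s : ℕ) (f : PowerSeries ℚ) : Prop :=
  ∃ p : ℚ[X], (∀ n, 0 ≤ p.coeff n) ∧ MajorizedBy f (p * geomSeries ^ s)

theorem PoleOrderLE.add {s : ℕ} {f g : PowerSeries ℚ} (hf : PoleOrderLE s f)
    (hg : PoleOrderLE s g) : PoleOrderLE s (f + g) := by
  obtain ⟨p, hp, hfp⟩ := hf
  obtain ⟨q, hq, hgq⟩ := hg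
  refine ⟨p + q, fun n => ?_, ?_⟩
  · rw [Polynomial.coeff_add]
    exact add_nonneg (hp n) (hq n)
  · rw [Polynomial.coe_add, add_mul]
    exact hfp.add hgq

theorem PoleOrderLE.mul {s t : ℕ} {f g : PowerSeries ℚ} (hf : PoleOrderLE s f)
    (hg : PoleOrderLE t g) : PoleOrderLE (s + t) (f * g) := by
  obtain ⟨p, hp, hfp⟩ := hf
  obtain ⟨q, hq, hgq⟩ := hg
  refine ⟨p * q, fun n => ?_, ?_⟩
  · rw [Polynomial.coeff_mul]
    exact Finset.sum_nonneg fun x _ => mul_nonneg (hp _) (hq _)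
  · rw [Polynomial.coe_mul, pow_add, mul_mul_mul_comm]
    exact hfp.mul hgq

theorem PoleOrderLE.succ {s : ℕ} {f : PowerSeries ℚ} (hf : PoleOrderLE s f) :
    PoleOrderLE (s + 1) f := by
  obtain ⟨p, hp, hfp⟩ := hf
  refine ⟨p, hp, ?_⟩
  rw [pow_succ, ← mul_assoc]
  simpa using hfp.mul one_majorizedBy_geomSeries

theorem PoleOrderLE.mono {s t : ℕ} (hst : s ≤ t) {f : PowerSeries ℚ} (hf : PoleOrderLE s f) :
    PoleOrderLE t f := by
  induction t, hst using Nat.le_induction with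
  | base => exact hf
  | succ t _ ih => exact ih.succ

theorem poleOrderLE_zero_X_pow (n : ℕ) : PoleOrderLE 0 ((PowerSeries.X : PowerSeries ℚ) ^ n) := by
  refine ⟨Polynomial.X ^ n, fun k => ?_, fun k => ?_⟩
  · rw [Polynomial.coeff_X_pow]
    split_ifs <;> norm_num
  · simp only [pow_zero, mul_one, Polynomial.coe_pow, Polynomial.coe_X, PowerSeries.coeff_X_pow]
    split_ifs <;> norm_num

theorem PoleOrderLE.smul {s : ℕ} {f : PowerSeries ℚ} (hf : PoleOrderLE s f) (c : ℚ) :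
    PoleOrderLE s (c • f) := by
  obtain ⟨p, hp, hfp⟩ := hf
  refine ⟨Polynomial.C |c| * p, fun n => ?_, fun n => ?_⟩
  · rw [Polynomial.coeff_C_mul]
    exact mul_nonneg (abs_nonneg c) (hp n)
  · rw [Polynomial.coe_mul, Polynomial.coe_C, mul_assoc, PowerSeries.coeff_C_mul,
      PowerSeries.coeff_smul, smul_eq_mul, abs_mul]
    exact mul_le_mul_of_nonneg_left (hfp n) (abs_nonneg c)

theorem poleOrderLE_one : PoleOrderLE 0 1 := by simpa using poleOrderLE_zero_X_pow 0

theorem poleOrderLE_geomSeries_pow (r : ℕ) : PoleOrderLE r (geomSeries ^ r) := by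
  refine ⟨1, fun n => ?_, ?_⟩
  · rw [Polynomial.coeff_one]
    split_ifs <;> norm_num
  · rw [Polynomial.coe_one, one_mul]
    exact MajorizedBy.pow (MajorizedBy.refl_of_nonneg fun n => by simp) r

theorem PoleOrderLE.dilate {s : ℕ} {f : PowerSeries ℚ} (hf : PoleOrderLE s f) {d : ℕ}
    (hd : d ≠ 0) : PoleOrderLE s (dilate d f) := by
  obtain ⟨p, hp, hfp⟩ := hf
  refine ⟨Polynomial.expand ℚ d p, fun n => ?_, ?_⟩
  · rw [Polynomial.coeff_expand (Nat.pos_of_ne_zero hd)]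
    split_ifs
    · exact hp _
    · exact le_rfl
  · have h1 : MajorizedBy (_root_.dilate d f) (_root_.dilate d (p * geomSeries ^ s)) := fun n => by
      rw [coeff_dilate, coeff_dilate]
      split_ifs
      · exact hfp _
      · simp
    have h2 : MajorizedBy (_root_.dilate d geomSeries) geomSeries := fun n => by
      rw [coeff_dilate]
      split_ifs <;> simp
    have h3 : MajorizedBy (_root_.dilate d (p : PowerSeries ℚ)) (Polynomial.expand ℚ d p : ℚ[X]) :=
      fun n => by
        rw [coeff_dilate, Polynomial.coeff_coe, Polynomial.coeff_coe,
          Polynomial.coeff_expand (Nat.pos_of_ne_zero hd)]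
        split_ifs
        · rw [abs_of_nonneg (hp _)]
        · simp
    refine h1.trans ?_
    have h4 : _root_.dilate d ((p : PowerSeries ℚ) * geomSeries ^ s) =
        _root_.dilate d (p : PowerSeries ℚ) * _root_.dilate d geomSeries ^ s := by
      simp only [dilate_eq_expand hd, map_mul, map_pow]
    rw [h4]
    exact h3.mul (h2.pow s)

/-- `f` has pole order less than `r`. -/
def PoleOrderLT (r : ℕ) (f : PowerSeries ℚ) : Prop := ∃ s < r, PoleOrderLE s f

theorem PoleOrderLE.lt {s r : ℕ} {f : PowerSeries ℚ} (hf : PoleOrderLE s f) (h : s < r) :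
    PoleOrderLT r f := ⟨s, h, hf⟩

theorem PoleOrderLT.le {r : ℕ} {f : PowerSeries ℚ} (hf : PoleOrderLT r f) : PoleOrderLE r f := by
  obtain ⟨s, hs, h⟩ := hf
  exact h.mono hs.le

theorem PoleOrderLT.add {r : ℕ} {f g : PowerSeries ℚ} (hf : PoleOrderLT r f)
    (hg : PoleOrderLT r g) : PoleOrderLT r (f + g) := by
  obtain ⟨s, hs, h⟩ := hf
  obtain ⟨t, ht, h'⟩ := hg
  exact ⟨max s t, max_lt hs ht, (h.mono (le_max_left _ _)).add (h'.mono (le_max_right _ _))⟩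

theorem PoleOrderLT.smul {r : ℕ} {f : PowerSeries ℚ} (hf : PoleOrderLT r f) (c : ℚ) :
    PoleOrderLT r (c • f) := by
  obtain ⟨s, hs, h⟩ := hf
  exact ⟨s, hs, h.smul c⟩

theorem PoleOrderLT.mul {r s : ℕ} {f g : PowerSeries ℚ} (hf : PoleOrderLT r f)
    (hg : PoleOrderLE s g) : PoleOrderLT (r + s) (f * g) := by
  obtain ⟨t, ht, h⟩ := hf
  exact ⟨t + s, by omega, h.mul hg⟩

theorem PoleOrderLT.sum {ι : Type*} {r : ℕ} (hr : 0 < r) (s : Finset ι) (f : ι → PowerSeries ℚ)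
    (h : ∀ i ∈ s, PoleOrderLT r (f i)) : PoleOrderLT r (∑ i ∈ s, f i) := by
  refine Finset.sum_induction f (PoleOrderLT r) (fun _ _ => PoleOrderLT.add) ?_ h
  exact ⟨0, hr, by simpa using poleOrderLE_one.smul 0⟩

/-- `f` agrees with `c / (1 - x)^r` up to terms of smaller pole order. -/
def HasLeadingPole (r : ℕ) (c : ℚ) (f : PowerSeries ℚ) : Prop :=
  PoleOrderLT r (f - c • geomSeries ^ r)

theorem HasLeadingPole.poleOrderLE {r : ℕ} {c : ℚ} {f : PowerSeries ℚ}
    (h : HasLeadingPole r c f) : PoleOrderLE r f := by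
  have := (PoleOrderLT.le h).add ((poleOrderLE_geomSeries_pow r).smul c)
  rwa [sub_add_cancel] at this

theorem HasLeadingPole.add {r : ℕ} {c d : ℚ} {f g : PowerSeries ℚ} (hf : HasLeadingPole r c f)
    (hg : HasLeadingPole r d g) : HasLeadingPole r (c + d) (f + g) := by
  have := PoleOrderLT.add hf hg
  rw [HasLeadingPole, add_smul]
  convert this using 1
  ring

theorem HasLeadingPole.smul {r : ℕ} {c : ℚ} {f : PowerSeries ℚ} (hf : HasLeadingPole r c f)
    (a : ℚ) : HasLeadingPole r (a * c) (a • f) := by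
  have := PoleOrderLT.smul hf a
  rwa [smul_sub, smul_smul] at this

theorem HasLeadingPole.sub {r : ℕ} {c d : ℚ} {f g : PowerSeries ℚ} (hf : HasLeadingPole r c f)
    (hg : HasLeadingPole r d g) : HasLeadingPole r (c - d) (f - g) := by
  have := hf.add (hg.smul (-1))
  rwa [neg_one_mul, neg_one_smul, ← sub_eq_add_neg, ← sub_eq_add_neg] at this

theorem PoleOrderLT.hasLeadingPole {r : ℕ} {f : PowerSeries ℚ} (h : PoleOrderLT r f) :
    HasLeadingPole r 0 f := by
  rwa [HasLeadingPole, zero_smul, sub_zero]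

theorem HasLeadingPole.mul {r s : ℕ} {c d : ℚ} {f g : PowerSeries ℚ} (hf : HasLeadingPole r c f)
    (hg : HasLeadingPole s d g) : HasLeadingPole (r + s) (c * d) (f * g) := by
  have h1 := PoleOrderLT.mul hf hg.poleOrderLE
  have h2 := PoleOrderLT.mul hg ((poleOrderLE_geomSeries_pow r).smul c)
  rw [add_comm s r] at h2
  have h3 := h1.add h2
  rw [HasLeadingPole]
  convert h3 using 1
  simp only [pow_add, PowerSeries.smul_eq_C_mul, map_mul]
  ring

theorem HasLeadingPole.sum {ι : Type*} {r : ℕ} (hr : 0 < r) (s : Finset ι) (c : ι → ℚ)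
    (f : ι → PowerSeries ℚ) (h : ∀ i ∈ s, HasLeadingPole r (c i) (f i)) :
    HasLeadingPole r (∑ i ∈ s, c i) (∑ i ∈ s, f i) := by
  rw [HasLeadingPole, Finset.sum_smul, ← Finset.sum_sub_distrib]
  exact PoleOrderLT.sum hr _ _ h

theorem hasLeadingPole_geomSeries_pow {r : ℕ} (hr : 0 < r) :
    HasLeadingPole r 1 (geomSeries ^ r) := by
  rw [HasLeadingPole, one_smul, sub_self]
  exact ⟨0, hr, by simpa using poleOrderLE_one.smul 0⟩

theorem tendsto_choose_div_pow (r : ℕ) :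
    Filter.Tendsto (fun n : ℕ => ((r + n).choose r : ℚ) / (n : ℚ) ^ r) Filter.atTop
      (nhds ((r.factorial : ℚ)⁻¹)) := by
  have h : ∀ j : ℕ, Filter.Tendsto (fun n : ℕ => ((n : ℚ) + j) / n) Filter.atTop (nhds 1) := by
    intro j
    have h1 : Filter.Tendsto (fun n : ℕ => 1 + (j : ℚ) / n) Filter.atTop (nhds (1 + 0)) :=
      tendsto_const_nhds.add (tendsto_const_nhds.div_atTop tendsto_natCast_atTop_atTop)
    rw [add_zero] at h1
    refine h1.congr' ?_
    filter_upwards [Filter.eventually_gt_atTop 0] with n hn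
    have : (n : ℚ) ≠ 0 := by positivity
    field_simp
  have hprod : Filter.Tendsto
      (fun n : ℕ => (∏ j ∈ Finset.range r, ((n : ℚ) + (j + 1 : ℕ)) / n) * (r.factorial : ℚ)⁻¹)
      Filter.atTop (nhds ((∏ _j ∈ Finset.range r, (1 : ℚ)) * (r.factorial : ℚ)⁻¹)) :=
    (tendsto_finsetProd _ fun j _ => h (j + 1)).mul_const _
  rw [Finset.prod_const_one, one_mul] at hprod
  refine hprod.congr fun n => ?_
  have hc : ((r + n).choose r : ℚ) * (r.factorial : ℚ) =
      ∏ j ∈ Finset.range r, ((n : ℚ) + (j + 1 : ℕ)) := by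
    have h1 := Nat.ascFactorial_eq_factorial_mul_choose n r
    have h2 := Nat.ascFactorial_eq_prod_range (n + 1) r
    rw [h1] at h2
    rw [add_comm r n, mul_comm]
    have h3 : ((r.factorial * (n + r).choose r : ℕ) : ℚ) =
      ((∏ i ∈ Finset.range r, (n + 1 + i) : ℕ) : ℚ) := congrArg _ h2
    push_cast at h3
    rw [h3]
    refine Finset.prod_congr rfl fun j _ => ?_
    push_cast
    ring
  rw [Finset.prod_div_distrib, Finset.prod_const, Finset.card_range, ← hc]
  have : (r.factorial : ℚ) ≠ 0 := by positivity
  field_simp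

theorem coeff_geomSeries_pow_succ (r n : ℕ) :
    PowerSeries.coeff n (geomSeries ^ (r + 1)) = ((r + n).choose r : ℚ) := by
  rw [geomSeries, PowerSeries.mk_one_pow_eq_mk_choose_add, PowerSeries.coeff_mk]

theorem coeff_geomSeries_pow_nonneg (s n : ℕ) : 0 ≤ PowerSeries.coeff n (geomSeries ^ s) :=
  ((MajorizedBy.refl_of_nonneg (f := geomSeries) fun n => by simp).pow s).nonneg n

theorem coeff_geomSeries_pow_mono {s : ℕ} (hs : s ≠ 0) :
    Monotone fun n => PowerSeries.coeff n (geomSeries ^ s) := by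
  obtain ⟨s, rfl⟩ := Nat.exists_eq_succ_of_ne_zero hs
  intro a b hab
  simp only [Nat.succ_eq_add_one, coeff_geomSeries_pow_succ]
  exact_mod_cast Nat.choose_le_choose s (by omega)

/-- Power series of pole order less than `r + 1` have coefficients `o(n^r)`. -/
theorem PoleOrderLT.tendsto {r : ℕ} {f : PowerSeries ℚ} (h : PoleOrderLT (r + 1) f) :
    Filter.Tendsto (fun n : ℕ => PowerSeries.coeff n f / (n : ℚ) ^ r) Filter.atTop (nhds 0) := by
  obtain ⟨s, hs, p, hp, hfp⟩ := h
  cases s with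
  | zero =>
    refine tendsto_const_nhds.congr' ?_
    filter_upwards [Filter.eventually_gt_atTop p.natDegree] with n hn
    have := hfp n
    rw [pow_zero, mul_one, Polynomial.coeff_coe,
      Polynomial.coeff_eq_zero_of_natDegree_lt hn] at this
    rw [abs_nonpos_iff.1 this, zero_div]
  | succ s =>
    have hbound : ∀ n, |PowerSeries.coeff n f| ≤ p.eval 1 * ((s + n).choose s : ℚ) := by
      intro n
      refine (hfp n).trans ?_
      rw [PowerSeries.coeff_mul, ← coeff_geomSeries_pow_succ]
      calc ∑ q ∈ Finset.HasAntidiagonal.antidiagonal n, PowerSeries.coeff q.1 (p : PowerSeries ℚ) *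
            PowerSeries.coeff q.2 (geomSeries ^ (s + 1))
          ≤ ∑ q ∈ Finset.HasAntidiagonal.antidiagonal n, p.coeff q.1 *
            PowerSeries.coeff n (geomSeries ^ (s + 1)) := by
            refine Finset.sum_le_sum fun q hq => ?_
            rw [Polynomial.coeff_coe]
            refine mul_le_mul_of_nonneg_left (coeff_geomSeries_pow_mono (Nat.succ_ne_zero s) ?_)
              (hp _)
            have := Finset.HasAntidiagonal.mem_antidiagonal.1 hq
            omega
        _ ≤ _ := by
            rw [← Finset.sum_mul]
            refine mul_le_mul_of_nonneg_right ?_ (coeff_geomSeries_pow_nonneg _ _)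
            rw [Finset.Nat.sum_antidiagonal_eq_sum_range_succ_mk,
              Polynomial.eval_eq_sum_range' (n := max (n + 1) (p.natDegree + 1)) (by omega)]
            simp only [one_pow, mul_one]
            exact Finset.sum_le_sum_of_subset_of_nonneg
              (Finset.range_subset_range.2 (le_max_left _ _)) fun i _ _ => hp i
    have hlim : Filter.Tendsto (fun n : ℕ => p.eval 1 * (((s + n).choose s : ℚ) / (n : ℚ) ^ s) *
        (1 / (n : ℚ))) Filter.atTop (nhds (p.eval 1 * ((s.factorial : ℚ)⁻¹) * 0)) :=
      ((tendsto_choose_div_pow s).const_mul _).mul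
        (tendsto_const_nhds.div_atTop tendsto_natCast_atTop_atTop)
    rw [mul_zero] at hlim
    have habs : ∀ᶠ n : ℕ in Filter.atTop, |PowerSeries.coeff n f / (n : ℚ) ^ r| ≤
        p.eval 1 * (((s + n).choose s : ℚ) / (n : ℚ) ^ s) * (1 / (n : ℚ)) := by
      filter_upwards [Filter.eventually_ge_atTop 1] with n hn
      have hn1 : (1 : ℚ) ≤ n := by exact_mod_cast hn
      have hn0 : (0 : ℚ) < n := by linarith
      rw [abs_div, abs_of_pos (pow_pos hn0 r)]
      calc |PowerSeries.coeff n f| / (n : ℚ) ^ r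
          ≤ |PowerSeries.coeff n f| / (n : ℚ) ^ (s + 1) :=
            div_le_div_of_nonneg_left (abs_nonneg _) (pow_pos hn0 _)
              (pow_le_pow_right₀ hn1 (by omega))
        _ ≤ p.eval 1 * ((s + n).choose s : ℚ) / (n : ℚ) ^ (s + 1) :=
            div_le_div_of_nonneg_right (hbound n) (pow_pos hn0 _).le
        _ = _ := by
            rw [pow_succ]
            field_simp
    have hneg := hlim.neg
    rw [neg_zero] at hneg
    refine tendsto_of_tendsto_of_tendsto_of_le_of_le' hneg hlim ?_ ?_
    · exact habs.mono fun n h => (abs_le.1 h).1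
    · exact habs.mono fun n h => (abs_le.1 h).2

theorem HasLeadingPole.tendsto {r : ℕ} {c : ℚ} {f : PowerSeries ℚ}
    (h : HasLeadingPole (r + 1) c f) :
    Filter.Tendsto (fun n : ℕ => PowerSeries.coeff n f / (n : ℚ) ^ r) Filter.atTop
      (nhds (c * (r.factorial : ℚ)⁻¹)) := by
  have h1 := (PoleOrderLT.tendsto h).add ((tendsto_choose_div_pow r).const_mul c)
  rw [zero_add] at h1
  refine h1.congr fun n => ?_
  rw [map_sub, PowerSeries.coeff_smul, coeff_geomSeries_pow_succ, smul_eq_mul]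
  ring

theorem Polynomial.eq_of_derivative_eq_of_eval_eq {p q : ℚ[X]} (a : ℚ)
    (hd : derivative p = derivative q) (he : p.eval a = q.eval a) : p = q := by
  have h : derivative (p - q) = 0 := by rw [derivative_sub, hd, sub_self]
  have h2 := Polynomial.eq_C_of_natDegree_eq_zero (derivative_eq_zero.1 h)
  have h3 : (p - q).eval a = 0 := by rw [eval_sub, he, sub_self]
  rw [h2, eval_C] at h3
  rw [h3, C_0] at h2
  exact sub_eq_zero.1 h2

theorem alternating_sum_choose_mul_succ_pow (n : ℕ) :
    ∑ j ∈ Finset.range (n + 2), ((n + 1).choose j : ℚ) * ((-1) ^ (n + 1 - j) * ((j : ℚ) + 1) ^ n)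
      = 0 := by
  have h := fwdDiff_iter_eq_sum_shift (1 : ℚ) (fun x : ℚ => x ^ n) (n + 1) 1
  rw [fwdDiff_iter_pow_eq_zero_of_lt (Nat.lt_succ_self n)] at h
  rw [Pi.zero_apply] at h
  rw [h]
  refine Finset.sum_congr rfl fun j _ => ?_
  simp
  ring

/-- The Abel polynomial identity. -/
theorem abel_identity (n : ℕ) :
    ∑ j ∈ Finset.range (n + 1), C ((n.choose j : ℚ) * ((j : ℚ) + 1) ^ (j - 1)) *
      (X - C (j : ℚ)) ^ (n - j) = (X + 1) ^ n := by
  induction n with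
  | zero => simp
  | succ n ih =>
    refine Polynomial.eq_of_derivative_eq_of_eval_eq (-1) ?_ ?_
    · rw [Finset.sum_range_succ, derivative_add, derivative_sum]
      have h1 : derivative ((X + 1 : ℚ[X]) ^ (n + 1)) = C ((n : ℚ) + 1) * (X + 1) ^ n := by
        rw [derivative_pow]
        simp
      rw [h1, ← ih, Finset.mul_sum, Nat.sub_self, pow_zero, mul_one, derivative_C, add_zero]
      refine Finset.sum_congr rfl fun j hj => ?_
      have hj : j ≤ n := by simpa [Nat.lt_succ_iff] using hj
      have h2 : (((n + 1).choose j : ℕ) : ℚ) * ((n - j : ℕ) + 1) = (n + 1) * n.choose j := by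
        have := Nat.choose_mul_succ_eq n j
        rw [Nat.succ_sub hj] at this
        have h := congrArg (Nat.cast (R := ℚ)) this
        push_cast at h
        linarith
      rw [derivative_C_mul, derivative_pow, Nat.succ_sub hj, derivative_sub, derivative_X,
        derivative_C, sub_zero, mul_one, Nat.succ_eq_add_one, Nat.add_sub_cancel, ← mul_assoc,
        ← mul_assoc, ← C_mul, ← C_mul]
      congr 2
      push_cast
      linear_combination ((j : ℚ) + 1) ^ (j - 1) * h2
    · rw [eval_finsetSum, eval_pow, eval_add, eval_X, eval_one, neg_add_cancel,
        zero_pow (Nat.succ_ne_zero n), ← alternating_sum_choose_mul_succ_pow n]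
      refine Finset.sum_congr rfl fun j hj => ?_
      have hj : j ≤ n + 1 := by simpa [Nat.lt_succ_iff] using hj
      simp only [eval_mul, eval_C, eval_pow, eval_sub, eval_X]
      rw [show (-1 - (j : ℚ)) = (-1) * (j + 1) by ring, mul_pow]
      rcases Nat.eq_zero_or_pos j with rfl | hj0
      · simp
      · obtain ⟨i, rfl⟩ : ∃ i, j = i + 1 := ⟨j - 1, by omega⟩
        rw [show n = (i + 1 - 1) + (n + 1 - (i + 1)) by omega, pow_add]
        simp only [show i + 1 - 1 + (n + 1 - (i + 1)) + 1 - (i + 1) = n + 1 - (i + 1) by omega]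
        rw [show i + 1 - 1 + (n + 1 - (i + 1)) + 1 = n + 1 by omega]
        ring

theorem ck_eq (k : ℕ) : ck k = ((k : ℚ) + 1) ^ (k - 1) / k.factorial := by
  cases k with
  | zero => simp [ck]
  | succ k =>
    rw [ck, ← zpow_natCast]
    simp

theorem dk_eq (k : ℕ) : dk k = ck k / ((k : ℚ) + 1) := by
  have h : (k : ℚ) + 1 ≠ 0 := by positivity
  rw [dk, ck, show (k : ℤ) - 2 = k - 1 - 1 by ring, zpow_sub_one₀ h]
  field_simp

theorem sum_antidiagonal_succ_mul_ck (k : ℕ) :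
    ∑ p ∈ Finset.HasAntidiagonal.antidiagonal k, ((p.1 : ℚ) + 1) * (ck p.1 * ck p.2) =
      (k + 1) * ck (k + 1) := by
  have h := congrArg (Polynomial.eval ((k : ℚ) + 1)) (abel_identity (k + 1))
  rw [eval_finsetSum, Finset.sum_range_succ] at h
  simp only [eval_mul, eval_C, eval_pow, eval_sub, eval_X, eval_add, eval_one] at h
  have hf : ((k + 1).factorial : ℚ) ≠ 0 := by positivity
  rw [← mul_right_inj' hf, ← Finset.Nat.sum_antidiagonal_swap,
    Finset.Nat.sum_antidiagonal_eq_sum_range_succ_mk, Finset.mul_sum]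
  have h1 : ∑ j ∈ Finset.range (k + 1), ((k + 1).choose j : ℚ) * ((j : ℚ) + 1) ^ (j - 1) *
      ((k : ℚ) + 1 - j) ^ (k + 1 - j) = (k + 1) * ((k : ℚ) + 2) ^ k := by
    have := eq_sub_of_add_eq h
    rw [this, pow_succ]
    simp
    ring
  rw [ck_eq (k + 1)]
  have h2 : ((k + 1).factorial : ℚ) * ((k + 1) * ((((k + 1 : ℕ) : ℚ) + 1) ^ (k + 1 - 1) /
      (k + 1).factorial)) = (k + 1) * ((k : ℚ) + 2) ^ k := by
    field_simp
    push_cast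
    ring
  rw [h2, ← h1]
  refine Finset.sum_congr rfl fun j hj => ?_
  obtain ⟨i, rfl⟩ : ∃ i, k = j + i := ⟨k - j, by simp at hj; omega⟩
  simp only [Prod.fst_swap, Prod.snd_swap]
  rw [show j + i - j = i by omega, show j + i + 1 - j = i + 1 by omega, ck_eq, ck_eq,
    Nat.cast_choose ℚ (show j ≤ j + i + 1 by omega), show j + i + 1 - j = i + 1 by omega]
  rw [Nat.factorial_succ i]
  push_cast
  rw [show (j : ℚ) + i + 1 - j = i + 1 by ring]
  have hi : (i : ℚ) + 1 ≠ 0 := by positivity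
  have hp : ((i : ℚ) + 1) ^ (i + 1) = (i + 1) * ((i + 1) * (i + 1) ^ (i - 1)) := by
    cases i with
    | zero => simp
    | succ i => simp; ring
  rw [hp]
  field_simp

theorem sum_antidiagonal_ck_mul_ck (k : ℕ) :
    ((k : ℚ) + 2) * ∑ p ∈ Finset.HasAntidiagonal.antidiagonal k, ck p.1 * ck p.2 =
      2 * ((k + 1) * ck (k + 1)) := by
  have h1 := sum_antidiagonal_succ_mul_ck k
  have h2 : ∑ p ∈ Finset.HasAntidiagonal.antidiagonal k, ((p.2 : ℚ) + 1) * (ck p.1 * ck p.2) =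
      (k + 1) * ck (k + 1) := by
    rw [← h1, ← Finset.Nat.sum_antidiagonal_swap]
    refine Finset.sum_congr rfl fun p _ => ?_
    simp only [Prod.fst_swap, Prod.snd_swap]
    ring
  rw [two_mul]
  nth_rewrite 1 [← h1]
  rw [← h2, ← Finset.sum_add_distrib, Finset.mul_sum]
  refine Finset.sum_congr rfl fun p hp => ?_
  rw [← Finset.HasAntidiagonal.mem_antidiagonal.1 hp]
  push_cast
  ring

theorem PoleOrderLE.sum {ι : Type*} {r : ℕ} (s : Finset ι) (f : ι → PowerSeries ℚ)
    (h : ∀ i ∈ s, PoleOrderLE r (f i)) : PoleOrderLE r (∑ i ∈ s, f i) := by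
  refine Finset.sum_induction f (PoleOrderLE r) (fun _ _ => PoleOrderLE.add) ?_ h
  have := (poleOrderLE_one.smul 0).mono (Nat.zero_le r)
  rwa [zero_smul] at this

theorem PoleOrderLE.dilateSum {F : ℕ → PowerSeries ℚ} {j r : ℕ}
    (h : ∀ i, 1 ≤ i → i ≤ j → PoleOrderLE r (F i)) : PoleOrderLE r (dilateSum F j) := by
  refine PoleOrderLE.sum _ _ fun d hd => ?_
  have hd0 := Nat.pos_of_mem_divisors hd
  exact ((h _ (Nat.div_pos (Nat.divisor_le hd) hd0) (Nat.div_le_self _ _)).dilate hd0.ne').smul _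

theorem poleOrderLT_dilateSum_sub {F : ℕ → PowerSeries ℚ} {j r : ℕ} (hj : 1 ≤ j) (hr : 0 < r)
    (h : ∀ i, 1 ≤ i → i < j → PoleOrderLT r (F i)) :
    PoleOrderLT r (dilateSum F j - (j : ℚ) • F j) := by
  rw [dilateSum, ← Finset.add_sum_erase _ _ (Nat.one_mem_divisors.2 (by omega : j ≠ 0)),
    Nat.div_one, dilate_one, add_sub_cancel_left]
  refine PoleOrderLT.sum hr _ _ fun d hd => ?_
  rw [Finset.mem_erase] at hd
  have hd0 := Nat.pos_of_mem_divisors hd.2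
  obtain ⟨s, hs, hF⟩ := h (j / d) (Nat.div_pos (Nat.divisor_le hd.2) hd0)
    (Nat.div_lt_self (by omega) (by omega))
  exact ((hF.dilate hd0.ne').smul _).lt hs

theorem HasLeadingPole.of_sub {r : ℕ} {c : ℚ} {f g : PowerSeries ℚ} (hf : HasLeadingPole r c f)
    (h : PoleOrderLT r (f - g)) : HasLeadingPole r c g := by
  have := hf.sub h.hasLeadingPole
  rwa [sub_zero, sub_sub_cancel] at this

theorem HasLeadingPole.of_smul {r : ℕ} {c a : ℚ} {f : PowerSeries ℚ} (ha : a ≠ 0)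
    (h : HasLeadingPole r (a * c) (a • f)) : HasLeadingPole r c f := by
  have := h.smul a⁻¹
  rwa [inv_mul_cancel_left₀ ha, smul_smul, inv_mul_cancel₀ ha, one_smul] at this

theorem poleOrderLE_X : PoleOrderLE 0 (PowerSeries.X : PowerSeries ℚ) := by
  simpa using poleOrderLE_zero_X_pow 1

theorem hasLeadingPole_coeffSeries_plethExp {m₀ k : ℕ} (hm : 1 ≤ m₀)
    (hH : HasLeadingPole ((k + 1) * m₀) (ck k) (coeffSeries m₀ Qfull k)) :
    HasLeadingPole ((k + 1) * m₀) (ck k)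
      (coeffSeries m₀ (plethExp fun i => Polynomial.X * Qplus i) (k + 2)) := by
  rw [coeffSeries_plethExp_X_mul_add_two]
  refine hH.of_sub ?_
  rw [sub_sub_cancel]
  refine PoleOrderLE.lt (s := 0) ?_ (by positivity)
  split_ifs
  · exact poleOrderLE_one.add (poleOrderLE_X.smul _)
  · have := poleOrderLE_one.smul 0
    rwa [zero_smul] at this

theorem hasLeadingPole_coeffSeries_Qplus_of {m₀ k : ℕ} (hm : 1 ≤ m₀)
    (hF : ∀ i ≤ k, PoleOrderLE (i * m₀) (coeffSeries m₀ Qplus i))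
    (hH : ∀ i ≤ k, HasLeadingPole ((i + 1) * m₀) (ck i) (coeffSeries m₀ Qfull i)) :
    HasLeadingPole ((k + 1) * m₀) (ck k) (coeffSeries m₀ Qplus (k + 1)) := by
  have hpos : 0 < (k + 1) * m₀ := by positivity
  have hrec := coeffSeries_plethExp_X_mul_rec m₀ (k + 2)
  rw [Finset.Nat.sum_antidiagonal_succ, coeffSeries_plethExp_X_mul_zero, one_mul] at hrec
  have hL : ∀ a ≤ k, PoleOrderLE (a * m₀)
      (coeffSeries m₀ (plethExp fun i => Polynomial.X * Qplus i) (a + 1)) := by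
    intro a ha
    cases a with
    | zero =>
      rw [zero_mul, zero_add, coeffSeries_plethExp_X_mul_one]
      exact poleOrderLE_X.smul _
    | succ a => exact (hasLeadingPole_coeffSeries_plethExp hm (hH a (by omega))).poleOrderLE
  have hrest : PoleOrderLT ((k + 1) * m₀)
      (∑ p ∈ Finset.HasAntidiagonal.antidiagonal (k + 1),
        coeffSeries m₀ (plethExp fun i => Polynomial.X * Qplus i) (p.1 + 1) *
          dilateSum (fun j => coeffSeries m₀ Qplus (j - 1)) p.2) := by
    refine PoleOrderLT.sum hpos _ _ fun p hp => ?_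
    obtain ⟨a, b⟩ := p
    have hab : a + b = k + 1 := Finset.HasAntidiagonal.mem_antidiagonal.1 hp
    cases b with
    | zero =>
      rw [dilateSum_zero, mul_zero]
      have := (poleOrderLE_one.smul 0).lt hpos
      rwa [zero_smul] at this
    | succ b =>
      have hD : PoleOrderLE (b * m₀)
          (dilateSum (fun j => coeffSeries m₀ Qplus (j - 1)) (b + 1)) :=
        PoleOrderLE.dilateSum fun i _ hi =>
          (hF (i - 1) (by omega)).mono (Nat.mul_le_mul_right _ (by omega))
      refine ((hL a (by omega)).mul hD).lt ?_
      rw [← add_mul]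
      exact Nat.mul_lt_mul_of_pos_right (by omega) hm
  have h1 := (hasLeadingPole_coeffSeries_plethExp hm (hH k le_rfl)).smul ((k + 2 : ℕ) : ℚ)
  rw [hrec] at h1
  have h2 := h1.sub hrest.hasLeadingPole
  rw [add_sub_cancel_right, sub_zero] at h2
  have h3 := h2.of_sub (poleOrderLT_dilateSum_sub (by omega) hpos fun i h1 h2 =>
    (hF (i - 1) (by omega)).lt (Nat.mul_lt_mul_of_pos_right (by omega) hm))
  exact h3.of_smul (by positivity)

theorem hasLeadingPole_coeffSeries_Qfull_of {m₀ k : ℕ} (hm : 1 ≤ m₀)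
    (hF : ∀ i ≤ k, HasLeadingPole ((i + 1) * m₀) (ck i) (coeffSeries m₀ Qplus (i + 1)))
    (hH : ∀ i ≤ k, HasLeadingPole ((i + 1) * m₀) (ck i) (coeffSeries m₀ Qfull i)) :
    HasLeadingPole ((k + 2) * m₀) (ck (k + 1)) (coeffSeries m₀ Qfull (k + 1)) := by
  refine HasLeadingPole.of_smul (a := ((k + 1 : ℕ) : ℚ)) (by positivity) ?_
  rw [coeffSeries_Qfull_rec, Finset.Nat.sum_antidiagonal_succ', dilateSum_zero, mul_zero, zero_add,
    Nat.cast_add_one, ← sum_antidiagonal_succ_mul_ck, ← Finset.Nat.sum_antidiagonal_swap]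
  refine HasLeadingPole.sum (by positivity) _ _ _ fun p hp => ?_
  have hp : p.1 + p.2 = k := Finset.HasAntidiagonal.mem_antidiagonal.1 hp
  have hpos : 0 < (p.2 + 1) * m₀ := by positivity
  have hD : HasLeadingPole ((p.2 + 1) * m₀) (((p.2 + 1 : ℕ) : ℚ) * ck p.2)
      (dilateSum (coeffSeries m₀ Qplus) (p.2 + 1)) := by
    refine ((hF p.2 (by omega)).smul _).of_sub ?_
    rw [← neg_sub, ← neg_one_smul ℚ]
    refine PoleOrderLT.smul (poleOrderLT_dilateSum_sub (by omega) hpos fun i h1 h2 => ?_) _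
    obtain ⟨i, rfl⟩ := Nat.exists_eq_add_of_le' h1
    exact (hF i (by omega)).poleOrderLE.lt (Nat.mul_lt_mul_of_pos_right h2 hm)
  have h := (hH p.1 (by omega)).mul hD
  rw [← add_mul, show p.1 + 1 + (p.2 + 1) = k + 2 by omega] at h
  convert h using 1
  simp only [Prod.fst_swap, Prod.snd_swap]
  push_cast
  ring

theorem hasLeadingPole_coeffSeries {m₀ : ℕ} (hm : 1 ≤ m₀) (k : ℕ) :
    HasLeadingPole ((k + 1) * m₀) (ck k) (coeffSeries m₀ Qplus (k + 1)) ∧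
      HasLeadingPole ((k + 1) * m₀) (ck k) (coeffSeries m₀ Qfull k) := by
  induction k using Nat.strong_induction_on with
  | _ k ih =>
    have hH : HasLeadingPole ((k + 1) * m₀) (ck k) (coeffSeries m₀ Qfull k) := by
      cases k with
      | zero =>
        rw [coeffSeries_Qfull_zero, zero_add, one_mul, ck_eq]
        simpa using hasLeadingPole_geomSeries_pow hm
      | succ k =>
        exact hasLeadingPole_coeffSeries_Qfull_of hm (fun i hi => (ih i (by omega)).1)
          fun i hi => (ih i (by omega)).2
    refine ⟨hasLeadingPole_coeffSeries_Qplus_of hm (fun i hi => ?_) fun i hi => ?_, hH⟩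
    · cases i with
      | zero =>
        rw [zero_mul, coeffSeries_Qplus_zero]
        exact poleOrderLE_X.smul _
      | succ i => exact (ih i (by omega)).1.poleOrderLE
    · rcases hi.eq_or_lt with rfl | hi
      · exact hH
      · exact (ih i hi).2

/-- The polynomials `𝒬ₙ` for `n ≥ 2`, extended by `0`. -/
noncomputable def Qtail (n : ℕ) : Qmt := if n < 2 then 0 else Qfull n

theorem coeffSeries_Qtail (m₀ k : ℕ) :
    coeffSeries m₀ Qtail k =
      coeffSeries m₀ Qfull k - if k = 0 then 1 + (m₀ : ℚ) • PowerSeries.X else 0 := by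
  ext n
  rw [map_sub, coeff_coeffSeries, coeff_coeffSeries, Qtail]
  match n with
  | 0 =>
    rw [Qfull_eq_plethExp, plethExp_zero, Polynomial.coeff_one]
    split_ifs <;> simp_all
  | 1 =>
    rw [Qfull_eq_plethExp, plethExp_one, Qplus_one, mPoly, Polynomial.coeff_C]
    split_ifs <;> simp_all [PowerSeries.coeff_one]
  | n + 2 =>
    rw [if_neg (by omega)]
    split_ifs <;> simp [PowerSeries.coeff_X, PowerSeries.coeff_one]

theorem hasLeadingPole_coeffSeries_Qtail {m₀ : ℕ} (hm : 1 ≤ m₀) (k : ℕ) :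
    HasLeadingPole ((k + 1) * m₀) (ck k) (coeffSeries m₀ Qtail k) := by
  rw [coeffSeries_Qtail, ← coeffSeries_plethExp_X_mul_add_two]
  exact hasLeadingPole_coeffSeries_plethExp hm (hasLeadingPole_coeffSeries hm k).2

theorem Prhs_eq {n : ℕ} (hn : 3 ≤ n) :
    Prhs n = Qfull n - Polynomial.C (Polynomial.C ((2 : ℚ)⁻¹)) * Polynomial.X *
      ((∑ p ∈ Finset.HasAntidiagonal.antidiagonal n, Qtail p.1 * Qtail p.2) -
        (if 2 ∣ n then tPow 2 (Qtail (n / 2)) else 0)) := by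
  rw [Prhs]
  congr 3
  · rw [Finset.Nat.sum_antidiagonal_eq_sum_range_succ_mk]
    refine (Finset.sum_congr rfl fun h hh => ?_).trans
      (Finset.sum_subset (f := fun h => Qtail h * Qtail (n - h)) (fun h hh => ?_)
        fun h h1 h2 => ?_)
    · rw [Finset.mem_Icc] at hh
      rw [Qtail, Qtail, if_neg (by omega), if_neg (by omega)]
    · rw [Finset.mem_Icc] at hh
      rw [Finset.mem_range]
      omega
    · rw [Finset.mem_range] at h1
      rw [Finset.mem_Icc] at h2
      rcases Nat.lt_or_ge h 2 with h3 | h3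
      · rw [Qtail, if_pos h3, zero_mul]
      · rw [Qtail, Qtail, if_pos (by omega : n - h < 2), mul_zero]
  · split_ifs with h
    · rw [Qtail, if_neg (by omega)]
    · rfl

/-- The degree `k` coefficient of the right-hand side of the relation defining `𝒫ₙ`. -/
noncomputable def rhsSeries (m₀ : ℕ) : ℕ → PowerSeries ℚ
  | 0 => coeffSeries m₀ Qfull 0
  | k + 1 => coeffSeries m₀ Qfull (k + 1) - (2 : ℚ)⁻¹ •
      ((∑ p ∈ Finset.HasAntidiagonal.antidiagonal k,
        coeffSeries m₀ Qtail p.1 * coeffSeries m₀ Qtail p.2) -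
        if 2 ∣ k then dilate 2 (coeffSeries m₀ Qtail (k / 2)) else 0)

theorem coeff_rhsSeries (m₀ k : ℕ) {n : ℕ} (hn : 3 ≤ n) :
    PowerSeries.coeff n (rhsSeries m₀ k) = ((Prhs n).coeff k).eval (m₀ : ℚ) := by
  rw [Prhs_eq hn, mul_assoc]
  cases k with
  | zero => simp [rhsSeries, coeff_coeffSeries]
  | succ k =>
    rw [rhsSeries, map_sub, coeff_coeffSeries, map_smul, map_sub, map_sum, Polynomial.coeff_sub,
      Polynomial.coeff_C_mul, Polynomial.coeff_X_mul, Polynomial.eval_sub, Polynomial.eval_mul,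
      Polynomial.eval_C, smul_eq_mul, Polynomial.coeff_sub, Polynomial.eval_sub,
      Polynomial.finsetSum_coeff, Polynomial.eval_finsetSum]
    congr 3
    · simp only [PowerSeries.coeff_mul, coeff_coeffSeries, Polynomial.coeff_mul,
        Polynomial.eval_finsetSum, Polynomial.eval_mul]
      rw [Finset.sum_comm]
    · have h := coeff_tPow two_ne_zero (Qtail (n / 2)) k
      split_ifs <;> simp_all [coeff_dilate, coeff_coeffSeries]

theorem hasLeadingPole_rhsSeries {m₀ : ℕ} (hm : 1 ≤ m₀) (k : ℕ) :
    HasLeadingPole ((k + 1) * m₀) (dk k) (rhsSeries m₀ k) := by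
  cases k with
  | zero =>
    have := (hasLeadingPole_coeffSeries hm 0).2
    rwa [show dk 0 = ck 0 by rw [dk_eq]; simp, rhsSeries]
  | succ k =>
    have h1 : HasLeadingPole ((k + 1 + 1) * m₀)
        (∑ p ∈ Finset.HasAntidiagonal.antidiagonal k, ck p.1 * ck p.2)
        (∑ p ∈ Finset.HasAntidiagonal.antidiagonal k,
          coeffSeries m₀ Qtail p.1 * coeffSeries m₀ Qtail p.2) := by
      refine HasLeadingPole.sum (by positivity) _ _ _ fun p hp => ?_
      have hp : p.1 + p.2 = k := Finset.HasAntidiagonal.mem_antidiagonal.1 hp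
      have := (hasLeadingPole_coeffSeries_Qtail hm p.1).mul
        (hasLeadingPole_coeffSeries_Qtail hm p.2)
      rwa [← add_mul, show p.1 + 1 + (p.2 + 1) = k + 1 + 1 by omega] at this
    have h2 : PoleOrderLT ((k + 1 + 1) * m₀)
        (if 2 ∣ k then dilate 2 (coeffSeries m₀ Qtail (k / 2)) else 0) := by
      split_ifs
      · refine ((hasLeadingPole_coeffSeries_Qtail hm (k / 2)).poleOrderLE.dilate two_ne_zero).lt ?_
        exact Nat.mul_lt_mul_of_pos_right (by omega) hm
      · have := (poleOrderLE_one.smul 0).lt (by positivity : 0 < (k + 1 + 1) * m₀)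
        rwa [zero_smul] at this
    have h3 := (hasLeadingPole_coeffSeries hm (k + 1)).2.sub
      ((h1.sub h2.hasLeadingPole).smul (2 : ℚ)⁻¹)
    rw [rhsSeries]
    convert h3 using 1
    have h4 := sum_antidiagonal_ck_mul_ck k
    have h5 : (k : ℚ) + 2 ≠ 0 := by positivity
    have h6 : (k : ℚ) + 1 + 1 ≠ 0 := by positivity
    rw [dk_eq]
    push_cast
    rw [sub_zero, div_eq_iff h6]
    linear_combination (1 / 2) * h4

theorem tendsto_Qnk_div_pow {m₀ : ℕ} (hm : 1 ≤ m₀) (k : ℕ) :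
    Filter.Tendsto (fun n : ℕ => (Qnk n k).eval (m₀ : ℚ) / (n : ℚ) ^ ((k + 1) * m₀ - 1))
      Filter.atTop (nhds (ck k * ((((k + 1) * m₀ - 1).factorial : ℕ) : ℚ)⁻¹)) := by
  have h := (hasLeadingPole_coeffSeries hm k).2
  have hpos : 0 < (k + 1) * m₀ := by positivity
  rw [← Nat.sub_add_cancel hpos] at h
  exact h.tendsto.congr fun n => by rw [coeff_coeffSeries, Qnk]

theorem eval_coeff_add_of_mul_eq {m₀ : ℕ} {f g : Qmt} (h : (1 + Polynomial.X) * f = g) (k : ℕ) :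
    (f.coeff (k + 1)).eval (m₀ : ℚ) =
      (g.coeff (k + 1)).eval (m₀ : ℚ) - (f.coeff k).eval (m₀ : ℚ) := by
  rw [← h, add_mul, one_mul, Polynomial.coeff_add, Polynomial.coeff_X_mul, Polynomial.eval_add,
    add_sub_cancel_right]

theorem eval_coeff_zero_of_mul_eq {m₀ : ℕ} {f g : Qmt} (h : (1 + Polynomial.X) * f = g) :
    (f.coeff 0).eval (m₀ : ℚ) = (g.coeff 0).eval (m₀ : ℚ) := by
  rw [← h, add_mul, one_mul, Polynomial.coeff_add, Polynomial.coeff_X_mul_zero, add_zero]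

theorem tendsto_eval_coeff_div_pow {m₀ : ℕ} (hm : 1 ≤ m₀) {P : ℕ → Qmt}
    (hP : ∀ n : ℕ, 3 ≤ n → (1 + Polynomial.X) * P n = Prhs n) (k : ℕ) :
    Filter.Tendsto (fun n : ℕ => ((P n).coeff k).eval (m₀ : ℚ) / (n : ℚ) ^ ((k + 1) * m₀ - 1))
      Filter.atTop (nhds (dk k * ((((k + 1) * m₀ - 1).factorial : ℕ) : ℚ)⁻¹)) := by
  have hR : ∀ k, Filter.Tendsto (fun n : ℕ => PowerSeries.coeff n (rhsSeries m₀ k) /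
      (n : ℚ) ^ ((k + 1) * m₀ - 1)) Filter.atTop
      (nhds (dk k * ((((k + 1) * m₀ - 1).factorial : ℕ) : ℚ)⁻¹)) := by
    intro k
    have h := hasLeadingPole_rhsSeries hm k
    have hpos : 0 < (k + 1) * m₀ := by positivity
    rw [← Nat.sub_add_cancel hpos] at h
    exact h.tendsto
  induction k with
  | zero =>
    refine (hR 0).congr' ?_
    filter_upwards [Filter.eventually_ge_atTop 3] with n hn
    rw [coeff_rhsSeries m₀ 0 hn, eval_coeff_zero_of_mul_eq (hP n hn)]
  | succ k ih =>
    have h0 : Filter.Tendsto (fun n : ℕ => ((n : ℚ) ^ m₀)⁻¹) Filter.atTop (nhds 0) :=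
      ((Filter.tendsto_pow_atTop (by omega : m₀ ≠ 0)).comp
        tendsto_natCast_atTop_atTop).inv_tendsto_atTop
    have h1 := (hR (k + 1)).sub (ih.mul h0)
    rw [mul_zero, sub_zero] at h1
    refine h1.congr' ?_
    filter_upwards [Filter.eventually_ge_atTop 3] with n hn
    have hn0 : (n : ℚ) ≠ 0 := by
      have : n ≠ 0 := by omega
      exact_mod_cast this
    rw [coeff_rhsSeries m₀ _ hn, eval_coeff_add_of_mul_eq (hP n hn) k, sub_div]
    congr 1
    rw [show (k + 1 + 1) * m₀ - 1 = ((k + 1) * m₀ - 1) + m₀ by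
      have : 0 < (k + 1) * m₀ := by positivity
      rw [add_mul (k + 1) 1 m₀]
      omega]
    rw [pow_add, ← div_div, div_eq_mul_inv _ ((n : ℚ) ^ m₀)]

theorem eventually_mul_lt_sq {a b c : ℕ → ℚ} {A B C : ℚ} {d e f : ℕ}
    (ha : Filter.Tendsto (fun n : ℕ => a n / (n : ℚ) ^ d) Filter.atTop (nhds A))
    (hb : Filter.Tendsto (fun n : ℕ => b n / (n : ℚ) ^ e) Filter.atTop (nhds B))
    (hc : Filter.Tendsto (fun n : ℕ => c n / (n : ℚ) ^ f) Filter.atTop (nhds C))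
    (hdef : d + f = 2 * e) (h : A * C < B ^ 2) :
    ∀ᶠ n in Filter.atTop, a n * c n < b n ^ 2 := by
  filter_upwards [(ha.mul hc).eventually_lt (hb.pow 2) h, Filter.eventually_ge_atTop 1]
    with n hlt hn
  have hn0 : (0 : ℚ) < n := by exact_mod_cast hn
  rw [div_mul_div_comm, ← pow_add, hdef, div_pow, ← pow_mul, mul_comm e 2] at hlt
  exact (div_lt_div_iff_of_pos_right (pow_pos hn0 _)).1 hlt

theorem succ_mul_factorial_sq_le (j r : ℕ) :
    (j + 2) * ((j + 2) * (r + 1) - 1).factorial ^ 2 ≤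
      (j + 1) * (((j + 1) * (r + 1) - 1).factorial * ((j + 3) * (r + 1) - 1).factorial) ∧
    (1 ≤ r → (j + 2) * ((j + 2) * (r + 1) - 1).factorial ^ 2 <
      (j + 1) * (((j + 1) * (r + 1) - 1).factorial * ((j + 3) * (r + 1) - 1).factorial)) := by
  have hfac : ∀ i, ((i + 1 + 1) * (r + 1) - 1).factorial =
      ((i + 1) * (r + 1) - 1).factorial *
        (((i + 1) * (r + 1)) * ∏ l ∈ Finset.range r, ((i + 1) * (r + 1) + (l + 1))) := by
    intro i
    have hpos : 0 < (i + 1) * (r + 1) := by positivity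
    have h := Nat.factorial_mul_ascFactorial ((i + 1) * (r + 1) - 1) (r + 1)
    rw [Nat.sub_add_cancel hpos, Nat.ascFactorial_eq_prod_range, Finset.prod_range_succ',
      add_zero, mul_comm (∏ l ∈ Finset.range r, _)] at h
    rw [h]
    congr 1
    rw [add_mul (i + 1) 1 (r + 1)]
    omega
  have h1 := hfac j
  have h2 := hfac (j + 1)
  rw [show j + 1 + 1 = j + 2 by ring] at h1 h2
  rw [show j + 2 + 1 = j + 3 by ring] at h2
  have hfp := Nat.factorial_pos ((j + 1) * (r + 1) - 1)
  have hgp := Nat.factorial_pos ((j + 2) * (r + 1) - 1)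
  set f := ((j + 1) * (r + 1) - 1).factorial
  set g := ((j + 2) * (r + 1) - 1).factorial
  set u := ∏ l ∈ Finset.range r, ((j + 1) * (r + 1) + (l + 1))
  set v := ∏ l ∈ Finset.range r, ((j + 2) * (r + 1) + (l + 1))
  have hle : u ≤ v := Finset.prod_le_prod' fun l _ =>
    Nat.add_le_add_right (Nat.mul_le_mul_right _ (by omega)) _
  have hL : (j + 2) * g ^ 2 = ((j + 1) * (j + 2) * (r + 1) * f * g) * u := by
    rw [sq]
    nth_rewrite 1 [h1]
    ring
  have hR : (j + 1) * (f * ((j + 3) * (r + 1) - 1).factorial) =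
      ((j + 1) * (j + 2) * (r + 1) * f * g) * v := by
    rw [h2]
    ring
  rw [hL, hR]
  refine ⟨Nat.mul_le_mul_left _ hle, fun hr => Nat.mul_lt_mul_of_pos_left ?_ (by positivity)⟩
  refine Finset.prod_lt_prod_of_nonempty (fun l _ => by positivity) (fun l _ => ?_)
    (Finset.nonempty_range_iff.2 (by omega))
  exact Nat.add_lt_add_right (Nat.mul_lt_mul_of_pos_right (by omega) (by omega)) _

theorem ck_eq_div (k : ℕ) : ck k = ((k : ℚ) + 1) ^ k / (k.factorial * (k + 1)) := by
  have h : (k : ℚ) + 1 ≠ 0 := by positivity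
  rw [ck_eq]
  cases k with
  | zero => simp
  | succ k =>
    rw [Nat.add_sub_cancel, pow_succ]
    field_simp

theorem ck_pos (k : ℕ) : 0 < ck k := by
  rw [ck_eq_div]
  positivity

theorem dk_pos (k : ℕ) : 0 < dk k := by
  rw [dk_eq]
  exact div_pos (ck_pos k) (by positivity)

theorem succ_mul_succ_lt_sq (j : ℕ) : ((j : ℚ) + 1) * (j + 3) < (j + 2) ^ 2 := by
  nlinarith

theorem mul_ck_mul_ck_lt (j : ℕ) :
    ((j : ℚ) + 1) * (ck j * ck (j + 2)) < (j + 2) * ck (j + 1) ^ 2 := by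
  have h := pow_lt_pow_left₀ (succ_mul_succ_lt_sq j) (by positivity) (Nat.succ_ne_zero j)
  have hD : (0 : ℚ) < j.factorial ^ 2 * (j + 1) ^ 2 * (j + 2) := by positivity
  have h1 : ((j : ℚ) + 1) * (ck j * ck (j + 2)) =
      (((j : ℚ) + 1) * (j + 3)) ^ (j + 1) / (j.factorial ^ 2 * (j + 1) ^ 2 * (j + 2)) := by
    rw [ck_eq_div, ck_eq_div, Nat.factorial_succ, Nat.factorial_succ, mul_pow]
    push_cast
    rw [show (j : ℚ) + 2 + 1 = j + 3 by ring, pow_succ _ (j + 1), pow_succ _ j]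
    field_simp
    ring
  have h2 : ((j : ℚ) + 2) * ck (j + 1) ^ 2 =
      (((j : ℚ) + 2) ^ 2) ^ (j + 1) / (j.factorial ^ 2 * (j + 1) ^ 2 * (j + 2)) := by
    rw [ck_eq_div, Nat.factorial_succ]
    push_cast
    rw [show (j : ℚ) + 1 + 1 = j + 2 by ring, ← pow_mul, mul_comm 2, pow_mul]
    field_simp
  rw [h1, h2]
  exact div_lt_div_of_pos_right h hD

theorem mul_dk_mul_dk_eq (j : ℕ) :
    ((j : ℚ) + 1) * (dk j * dk (j + 2)) =
      (((j : ℚ) + 1) * (j + 3)) ^ j / (j.factorial ^ 2 * (j + 1) ^ 2 * (j + 2)) := by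
  rw [dk_eq, dk_eq, ck_eq_div, ck_eq_div, Nat.factorial_succ, Nat.factorial_succ, mul_pow]
  push_cast
  rw [show (j : ℚ) + 2 + 1 = j + 3 by ring, pow_succ _ (j + 1), pow_succ _ j]
  field_simp
  ring

theorem mul_dk_sq_eq (j : ℕ) :
    ((j : ℚ) + 2) * dk (j + 1) ^ 2 =
      (((j : ℚ) + 2) ^ 2) ^ j / (j.factorial ^ 2 * (j + 1) ^ 2 * (j + 2)) := by
  rw [dk_eq, ck_eq_div, Nat.factorial_succ]
  push_cast
  rw [show (j : ℚ) + 1 + 1 = j + 2 by ring, ← pow_mul, mul_comm 2, pow_mul, pow_succ _ j]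
  field_simp

theorem mul_dk_mul_dk_le (j : ℕ) :
    ((j : ℚ) + 1) * (dk j * dk (j + 2)) ≤ (j + 2) * dk (j + 1) ^ 2 := by
  rw [mul_dk_mul_dk_eq, mul_dk_sq_eq]
  exact div_le_div_of_nonneg_right
    (pow_le_pow_left₀ (by positivity) (succ_mul_succ_lt_sq j).le j) (by positivity)

theorem mul_dk_mul_dk_lt {j : ℕ} (hj : 1 ≤ j) :
    ((j : ℚ) + 1) * (dk j * dk (j + 2)) < (j + 2) * dk (j + 1) ^ 2 := by
  rw [mul_dk_mul_dk_eq, mul_dk_sq_eq]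
  exact div_lt_div_of_pos_right
    (pow_lt_pow_left₀ (succ_mul_succ_lt_sq j) (by positivity) (by omega)) (by positivity)

theorem mul_inv_mul_mul_inv_lt_sq {a b c f g h u v : ℚ} (hb : 0 < b) (hf : 0 < f) (hg : 0 < g)
    (hh : 0 < h) (hu : 0 < u) (h1 : u * (a * c) ≤ v * b ^ 2)
    (h2 : v * g ^ 2 ≤ u * (f * h))
    (hlt : u * (a * c) < v * b ^ 2 ∨ v * g ^ 2 < u * (f * h)) :
    (a * f⁻¹) * (c * h⁻¹) < (b * g⁻¹) ^ 2 := by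
  have key : a * c * g ^ 2 < b ^ 2 * (f * h) := by
    have h3 : u * (a * c) * g ^ 2 ≤ v * b ^ 2 * g ^ 2 :=
      mul_le_mul_of_nonneg_right h1 (by positivity)
    have h4 : v * g ^ 2 * b ^ 2 ≤ u * (f * h) * b ^ 2 :=
      mul_le_mul_of_nonneg_right h2 (by positivity)
    refine lt_of_mul_lt_mul_left ?_ hu.le
    rcases hlt with h5 | h5
    · have := mul_lt_mul_of_pos_right h5 (by positivity : 0 < g ^ 2)
      linarith
    · have := mul_lt_mul_of_pos_right h5 (by positivity : 0 < b ^ 2)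
      linarith
  have e1 : (a * f⁻¹) * (c * h⁻¹) = a * c / (f * h) := by field_simp
  have e2 : (b * g⁻¹) ^ 2 = b ^ 2 / g ^ 2 := by field_simp
  rw [e1, e2, div_lt_div_iff₀ (by positivity) (by positivity)]
  exact key

theorem eventually_Qnk_mul_lt_sq {m₀ : ℕ} (hm : 1 ≤ m₀) (j : ℕ) :
    ∀ᶠ n in Filter.atTop, (Qnk n j).eval (m₀ : ℚ) * (Qnk n (j + 2)).eval (m₀ : ℚ) <
      (Qnk n (j + 1)).eval (m₀ : ℚ) ^ 2 := by
  obtain ⟨r, rfl⟩ := Nat.exists_eq_add_of_le' hm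
  refine eventually_mul_lt_sq (tendsto_Qnk_div_pow hm j) (tendsto_Qnk_div_pow hm (j + 1))
    (tendsto_Qnk_div_pow hm (j + 2)) ?_ ?_
  · have h1 : (j + 1 + 1) * (r + 1) = (j + 1) * (r + 1) + (r + 1) := by ring
    have h2 : (j + 2 + 1) * (r + 1) = (j + 1) * (r + 1) + 2 * (r + 1) := by ring
    have : 0 < (j + 1) * (r + 1) := by positivity
    omega
  · refine mul_inv_mul_mul_inv_lt_sq (u := (j : ℚ) + 1) (v := j + 2) (ck_pos _) (by positivity)
      (by positivity) (by positivity) (by positivity) (mul_ck_mul_ck_lt j).le ?_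
      (Or.inl (mul_ck_mul_ck_lt j))
    exact_mod_cast (succ_mul_factorial_sq_le j r).1

theorem eventually_eval_coeff_mul_lt_sq {m₀ : ℕ} (hm : 1 ≤ m₀) {P : ℕ → Qmt}
    (hP : ∀ n : ℕ, 3 ≤ n → (1 + Polynomial.X) * P n = Prhs n) {j : ℕ} (h : 1 < m₀ ∨ 1 ≤ j) :
    ∀ᶠ n in Filter.atTop, ((P n).coeff j).eval (m₀ : ℚ) * ((P n).coeff (j + 2)).eval (m₀ : ℚ) <
      ((P n).coeff (j + 1)).eval (m₀ : ℚ) ^ 2 := by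
  obtain ⟨r, rfl⟩ := Nat.exists_eq_add_of_le' hm
  refine eventually_mul_lt_sq (tendsto_eval_coeff_div_pow hm hP j)
    (tendsto_eval_coeff_div_pow hm hP (j + 1)) (tendsto_eval_coeff_div_pow hm hP (j + 2)) ?_ ?_
  · have h1 : (j + 1 + 1) * (r + 1) = (j + 1) * (r + 1) + (r + 1) := by ring
    have h2 : (j + 2 + 1) * (r + 1) = (j + 1) * (r + 1) + 2 * (r + 1) := by ring
    have : 0 < (j + 1) * (r + 1) := by positivity
    omega
  · refine mul_inv_mul_mul_inv_lt_sq (u := (j : ℚ) + 1) (v := j + 2) (dk_pos _) (by positivity)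
      (by positivity) (by positivity) (by positivity) (mul_dk_mul_dk_le j) ?_
      ?_
    · exact_mod_cast (succ_mul_factorial_sq_le j r).1
    · rcases h with h | h
      · right
        exact_mod_cast (succ_mul_factorial_sq_le j r).2 (by omega)
      · exact Or.inl (mul_dk_mul_dk_lt h)

theorem geomSeries_mul_one_sub_X : geomSeries * (1 - PowerSeries.X) = 1 :=
  PowerSeries.mk_one_mul_one_sub_eq_one ℚ

theorem dilate_X_pow_mul (d k : ℕ) (hd : d ≠ 0) (f : PowerSeries ℚ) :
    dilate d (PowerSeries.X ^ k * f) = PowerSeries.X ^ (d * k) * dilate d f := by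
  rw [dilate_eq_expand hd, dilate_eq_expand hd, map_mul, map_pow, PowerSeries.expand_X, ← pow_mul]

theorem dilate_X (d : ℕ) (hd : d ≠ 0) :
    dilate d (PowerSeries.X : PowerSeries ℚ) = PowerSeries.X ^ d := by
  rw [dilate_eq_expand hd, PowerSeries.expand_X]

theorem dilateSum_prime (F : ℕ → PowerSeries ℚ) {p : ℕ} (hp : p.Prime) :
    dilateSum F p = (p : PowerSeries ℚ) * F p + dilate p (F 1) := by
  rw [dilateSum, hp.divisors, Finset.sum_pair hp.one_lt.ne, Nat.div_one, Nat.div_self hp.pos,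
    dilate_one, Nat.cast_one, one_smul, Nat.cast_smul_eq_nsmul, nsmul_eq_mul]

theorem coeffSeries_one_Qplus_zero : coeffSeries 1 Qplus 0 = PowerSeries.X := by
  rw [coeffSeries_Qplus_zero, Nat.cast_one, one_smul]

theorem coeffSeries_one_Qfull_zero : coeffSeries 1 Qfull 0 = geomSeries := by
  rw [coeffSeries_Qfull_zero, pow_one]

theorem coeffSeries_one_Qtail_zero :
    coeffSeries 1 Qtail 0 = PowerSeries.X ^ 2 * geomSeries := by
  rw [coeffSeries_Qtail, if_pos rfl, coeffSeries_one_Qfull_zero, Nat.cast_one, one_smul]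
  linear_combination (1 + PowerSeries.X) * geomSeries_mul_one_sub_X

theorem coeffSeries_one_plethExp_one :
    coeffSeries 1 (plethExp fun i => Polynomial.X * Qplus i) 1 = PowerSeries.X := by
  rw [coeffSeries_plethExp_X_mul_one, Nat.cast_one, one_smul]

theorem coeffSeries_one_plethExp_two :
    coeffSeries 1 (plethExp fun i => Polynomial.X * Qplus i) 2 =
      PowerSeries.X ^ 2 * geomSeries := by
  rw [← coeffSeries_one_Qtail_zero, coeffSeries_Qtail, ← coeffSeries_plethExp_X_mul_add_two]

theorem coeffSeries_one_Qplus_one :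
    coeffSeries 1 Qplus 1 = PowerSeries.X ^ 3 * geomSeries := by
  have h := coeffSeries_plethExp_X_mul_rec 1 2
  rw [Nat.cast_smul_eq_nsmul, nsmul_eq_mul, Finset.Nat.sum_antidiagonal_eq_sum_range_succ_mk] at h
  simp only [Nat.succ_eq_add_one, Finset.sum_range_succ, Finset.sum_range_zero] at h
  simp only [dilateSum_zero, dilateSum_one, dilateSum_prime _ Nat.prime_two,
    coeffSeries_one_plethExp_one, coeffSeries_one_plethExp_two,
    coeffSeries_plethExp_X_mul_zero, coeffSeries_one_Qplus_zero,
    dilate_X _ two_ne_zero, Nat.sub_zero, Nat.sub_self, Nat.reduceSub, Nat.cast_ofNat] at h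
  have h2 : (2 : PowerSeries ℚ) ≠ 0 := fun h0 => by
    have := congrArg PowerSeries.constantCoeff h0
    rw [map_ofNat, map_zero] at this
    norm_num at this
  refine mul_left_cancel₀ h2 ?_
  linear_combination -h + 2 * PowerSeries.X ^ 2 * geomSeries_mul_one_sub_X

theorem coeffSeries_one_Qfull_one :
    coeffSeries 1 Qfull 1 = PowerSeries.X ^ 3 * geomSeries ^ 2 := by
  have h := coeffSeries_Qfull_rec 1 1
  rw [Nat.cast_one, one_smul, Finset.Nat.sum_antidiagonal_eq_sum_range_succ_mk] at h
  simp only [Nat.succ_eq_add_one, Finset.sum_range_succ, Finset.sum_range_zero] at h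
  simp only [dilateSum_zero, dilateSum_one, coeffSeries_one_Qfull_zero, coeffSeries_one_Qplus_one,
    Nat.sub_zero, Nat.sub_self] at h
  rw [h]
  ring

theorem coeffSeries_one_Qtail_one :
    coeffSeries 1 Qtail 1 = PowerSeries.X ^ 3 * geomSeries ^ 2 := by
  rw [coeffSeries_Qtail, if_neg one_ne_zero, sub_zero, coeffSeries_one_Qfull_one]

theorem coeffSeries_one_Qplus_two :
    coeffSeries 1 Qplus 2 = PowerSeries.X ^ 4 * geomSeries ^ 2 := by
  have h := coeffSeries_plethExp_X_mul_rec 1 3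
  rw [Nat.cast_smul_eq_nsmul, nsmul_eq_mul, Finset.Nat.sum_antidiagonal_eq_sum_range_succ_mk] at h
  simp only [Nat.succ_eq_add_one, Finset.sum_range_succ, Finset.sum_range_zero] at h
  have h3 : coeffSeries 1 (plethExp fun i => Polynomial.X * Qplus i) 3 =
      PowerSeries.X ^ 3 * geomSeries ^ 2 := by
    rw [coeffSeries_plethExp_X_mul_add_two, if_neg one_ne_zero, sub_zero,
      coeffSeries_one_Qfull_one]
  simp only [dilateSum_zero, dilateSum_one, dilateSum_prime _ Nat.prime_two,
    dilateSum_prime _ Nat.prime_three, coeffSeries_one_plethExp_one, h3,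
    coeffSeries_one_plethExp_two,
    coeffSeries_plethExp_X_mul_zero, coeffSeries_one_Qplus_zero,
    dilate_X _ two_ne_zero, dilate_X _ three_ne_zero, Nat.sub_zero, Nat.sub_self, Nat.reduceSub,
    Nat.cast_ofNat, coeffSeries_one_Qplus_one] at h
  have h2 : (3 : PowerSeries ℚ) ≠ 0 := fun h0 => by
    have := congrArg PowerSeries.constantCoeff h0
    rw [map_ofNat, map_zero] at this
    norm_num at this
  refine mul_left_cancel₀ h2 ?_
  linear_combination -h + (3 * PowerSeries.X ^ 3 * geomSeries + 2 * PowerSeries.X ^ 3) *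
    geomSeries_mul_one_sub_X

theorem two_mul_coeffSeries_one_Qfull_two :
    2 * coeffSeries 1 Qfull 2 = PowerSeries.X ^ 6 * geomSeries ^ 3 +
      2 * (PowerSeries.X ^ 4 * geomSeries ^ 3) +
      PowerSeries.X ^ 6 * (geomSeries * dilate 2 geomSeries) := by
  have h := coeffSeries_Qfull_rec 1 2
  rw [Nat.cast_smul_eq_nsmul, nsmul_eq_mul, Finset.Nat.sum_antidiagonal_eq_sum_range_succ_mk] at h
  simp only [Nat.succ_eq_add_one, Finset.sum_range_succ, Finset.sum_range_zero] at h
  simp only [dilateSum_zero, dilateSum_one, dilateSum_prime _ Nat.prime_two,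
    coeffSeries_one_Qfull_zero, coeffSeries_one_Qplus_one, coeffSeries_one_Qplus_two,
    coeffSeries_one_Qfull_one, dilate_X_pow_mul _ _ two_ne_zero,
    Nat.sub_zero, Nat.sub_self, Nat.reduceSub, Nat.cast_ofNat] at h
  rw [h]
  ring

theorem two_smul_half_smul (f : PowerSeries ℚ) : 2 * ((2 : ℚ)⁻¹ • f) = f := by
  rw [PowerSeries.smul_eq_C_mul, ← mul_assoc, show (2 : PowerSeries ℚ) = PowerSeries.C (2 : ℚ) by
    rw [map_ofNat], ← map_mul, mul_inv_cancel₀ two_ne_zero, map_one, one_mul]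

theorem two_mul_rhsSeries_one_one :
    2 * rhsSeries 1 1 = 2 * (PowerSeries.X ^ 3 * geomSeries ^ 2) -
      (PowerSeries.X ^ 4 * geomSeries ^ 2 - PowerSeries.X ^ 4 * dilate 2 geomSeries) := by
  rw [rhsSeries, mul_sub, two_smul_half_smul]
  simp only [Finset.Nat.antidiagonal_zero, Finset.sum_singleton, dvd_zero, if_true, Nat.zero_div,
    coeffSeries_one_Qtail_zero, dilate_X_pow_mul _ _ two_ne_zero, zero_add,
    coeffSeries_one_Qfull_one]
  ring

theorem two_mul_rhsSeries_one_two :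
    2 * rhsSeries 1 2 = 2 * (PowerSeries.X ^ 4 * geomSeries ^ 2) +
      (PowerSeries.X ^ 6 * geomSeries ^ 3 +
        PowerSeries.X ^ 6 * (geomSeries * dilate 2 geomSeries)) := by
  rw [rhsSeries, mul_sub, two_smul_half_smul, two_mul_coeffSeries_one_Qfull_two,
    Finset.Nat.sum_antidiagonal_succ]
  simp only [Finset.Nat.antidiagonal_zero, Finset.sum_singleton, Nat.dvd_one, zero_add,
    OfNat.ofNat_ne_one, if_false, coeffSeries_one_Qtail_zero, coeffSeries_one_Qtail_one]
  linear_combination (2 * PowerSeries.X ^ 4 * geomSeries ^ 2) * geomSeries_mul_one_sub_X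

theorem coeff_geomSeries_mul_dilate_two (n : ℕ) :
    PowerSeries.coeff n (geomSeries * dilate 2 geomSeries) = ((n / 2 : ℕ) : ℚ) + 1 := by
  have h : geomSeries * dilate 2 geomSeries =
      dilate 2 geomSeries + PowerSeries.X * (geomSeries * dilate 2 geomSeries) := by
    linear_combination dilate 2 geomSeries * geomSeries_mul_one_sub_X
  induction n with
  | zero =>
    rw [PowerSeries.coeff_mul, Finset.Nat.antidiagonal_zero, Finset.sum_singleton, coeff_dilate]
    simp
  | succ n ih =>
    rw [h, map_add, PowerSeries.coeff_succ_X_mul, ih, coeff_dilate, PowerSeries.coeff_mk]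
    rcases Nat.even_or_odd' n with ⟨b, rfl | rfl⟩
    · rw [if_neg (by omega), show (2 * b + 1) / 2 = b by omega, show 2 * b / 2 = b by omega]
      ring
    · rw [if_pos (by omega), show (2 * b + 1 + 1) / 2 = b + 1 by omega,
        show (2 * b + 1) / 2 = b by omega, Pi.one_apply]
      push_cast
      ring

theorem coeff_geomSeries_sq (n : ℕ) : PowerSeries.coeff n (geomSeries ^ 2) = (n : ℚ) + 1 := by
  rw [coeff_geomSeries_pow_succ, Nat.choose_one_right]
  push_cast
  ring

theorem coeff_geomSeries_cube (n : ℕ) :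
    PowerSeries.coeff n (geomSeries ^ 3) = ((n : ℚ) + 1) * (n + 2) / 2 := by
  rw [coeff_geomSeries_pow_succ, Nat.cast_choose_two]
  push_cast
  ring

theorem coeff_rhsSeries_one_zero (n : ℕ) : PowerSeries.coeff n (rhsSeries 1 0) = 1 := by
  rw [rhsSeries, coeffSeries_one_Qfull_zero, PowerSeries.coeff_mk, Pi.one_apply]

theorem coeff_two_mul (n : ℕ) (f : PowerSeries ℚ) :
    PowerSeries.coeff n (2 * f) = 2 * PowerSeries.coeff n f := by
  rw [two_mul, map_add, two_mul]

theorem two_mul_coeff_rhsSeries_one_one (n : ℕ) :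
    2 * PowerSeries.coeff (n + 6) (rhsSeries 1 1) =
      2 * ((n : ℚ) + 4) - (((n : ℚ) + 3) - if 2 ∣ n then 1 else 0) := by
  rw [← coeff_two_mul, two_mul_rhsSeries_one_one]
  simp only [map_sub, coeff_two_mul]
  rw [show n + 6 = n + 3 + 3 by ring, PowerSeries.coeff_X_pow_mul,
    show n + 3 + 3 = n + 2 + 4 by ring, PowerSeries.coeff_X_pow_mul, PowerSeries.coeff_X_pow_mul,
    coeff_geomSeries_sq, coeff_geomSeries_sq, coeff_dilate]
  simp only [Nat.dvd_add_self_right, PowerSeries.coeff_mk, Pi.one_apply]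
  push_cast
  ring

theorem two_mul_coeff_rhsSeries_one_two (n : ℕ) :
    2 * PowerSeries.coeff (n + 6) (rhsSeries 1 2) =
      2 * ((n : ℚ) + 3) + (((n : ℚ) + 1) * (n + 2) / 2 + (((n / 2 : ℕ) : ℚ) + 1)) := by
  rw [← coeff_two_mul, two_mul_rhsSeries_one_two]
  simp only [map_add, coeff_two_mul, PowerSeries.coeff_X_pow_mul, coeff_geomSeries_cube,
    coeff_geomSeries_mul_dilate_two]
  rw [show n + 6 = n + 2 + 4 by ring, PowerSeries.coeff_X_pow_mul, coeff_geomSeries_sq]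
  push_cast
  ring

theorem eval_coeff_mul_le_sq_of_one {P : ℕ → Qmt}
    (hP : ∀ n : ℕ, 3 ≤ n → (1 + Polynomial.X) * P n = Prhs n) (n : ℕ) :
    ((P (n + 6)).coeff 0).eval ((1 : ℕ) : ℚ) * ((P (n + 6)).coeff 2).eval ((1 : ℕ) : ℚ) ≤
      ((P (n + 6)).coeff 1).eval ((1 : ℕ) : ℚ) ^ 2 := by
  have hn : 3 ≤ n + 6 := by omega
  have h0 := eval_coeff_zero_of_mul_eq (m₀ := 1) (hP _ hn)
  have h1 := eval_coeff_add_of_mul_eq (m₀ := 1) (hP _ hn) 0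
  have h2 := eval_coeff_add_of_mul_eq (m₀ := 1) (hP _ hn) 1
  rw [← coeff_rhsSeries _ _ hn] at h0 h1 h2
  rw [coeff_rhsSeries_one_zero] at h0
  have r1 := two_mul_coeff_rhsSeries_one_one n
  have r2 := two_mul_coeff_rhsSeries_one_two n
  rw [zero_add] at h1
  rw [h0] at h1 ⊢
  rw [one_add_one_eq_two] at h2
  rcases Nat.even_or_odd' n with ⟨b, rfl | rfl⟩
  · rw [if_pos (by omega)] at r1
    rw [show 2 * b / 2 = b by omega] at r2
    push_cast at r1 r2
    have e1 : ((P (2 * b + 6)).coeff 1).eval ((1 : ℕ) : ℚ) = b + 2 := by linarith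
    have e2 : ((P (2 * b + 6)).coeff 2).eval ((1 : ℕ) : ℚ) = (b + 2) * (b + 1) := by
      rw [h2, e1]
      linear_combination r2 / 2
    rw [e1, e2]
    have : (0 : ℚ) ≤ b := by positivity
    nlinarith
  · rw [if_neg (by omega)] at r1
    rw [show (2 * b + 1) / 2 = b by omega] at r2
    push_cast at r1 r2
    have e1 : ((P (2 * b + 1 + 6)).coeff 1).eval ((1 : ℕ) : ℚ) = b + 2 := by linarith
    have e2 : ((P (2 * b + 1 + 6)).coeff 2).eval ((1 : ℕ) : ℚ) = (b + 2) ^ 2 := by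
      rw [h2, e1]
      linear_combination r2 / 2
    rw [e1, e2, one_mul]

/-- Let `𝒫ₙ` (for `n ≥ 3`) be the unique polynomials satisfying
`(1+t)·𝒫ₙ = 𝒬ₙ − (t/2)(Σ_{h=2}^{n-2} 𝒬_h 𝒬_{n-h} − 𝒬_{n/2}^{[2]})`.  For fixed `m₀ ≥ 1` and
`k ≥ 1`, for all sufficiently large `n`, `𝒫_{n,k}(m₀)² ≥ 𝒫_{n,k−1}(m₀)·𝒫_{n,k+1}(m₀)` and
`𝒬_{n,k}(m₀)² ≥ 𝒬_{n,k−1}(m₀)·𝒬_{n,k+1}(m₀)`; moreover if `m₀ > 1` both inequalities are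
strict for all sufficiently large `n`. -/
theorem asymptotic_log_concavity_of_values (m₀ k : ℕ) (hm : 1 ≤ m₀) (hk : 1 ≤ k)
    (P : ℕ → Qmt) (hP : ∀ n : ℕ, 3 ≤ n → (1 + Polynomial.X) * P n = Prhs n) :
    (∃ N : ℕ, ∀ n : ℕ, N ≤ n →
      ((P n).coeff k).eval (m₀ : ℚ) ^ 2 ≥
          ((P n).coeff (k - 1)).eval (m₀ : ℚ) * ((P n).coeff (k + 1)).eval (m₀ : ℚ) ∧
      (Qnk n k).eval (m₀ : ℚ) ^ 2 ≥
          (Qnk n (k - 1)).eval (m₀ : ℚ) * (Qnk n (k + 1)).eval (m₀ : ℚ)) ∧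
    (1 < m₀ → ∃ N : ℕ, ∀ n : ℕ, N ≤ n →
      ((P n).coeff k).eval (m₀ : ℚ) ^ 2 >
          ((P n).coeff (k - 1)).eval (m₀ : ℚ) * ((P n).coeff (k + 1)).eval (m₀ : ℚ) ∧
      (Qnk n k).eval (m₀ : ℚ) ^ 2 >
          (Qnk n (k - 1)).eval (m₀ : ℚ) * (Qnk n (k + 1)).eval (m₀ : ℚ)) := by
  have hQ : ∀ᶠ n in Filter.atTop, (Qnk n (k - 1)).eval (m₀ : ℚ) * (Qnk n (k + 1)).eval (m₀ : ℚ) <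
      (Qnk n k).eval (m₀ : ℚ) ^ 2 := by
    obtain ⟨j, rfl⟩ := Nat.exists_eq_add_of_le' hk
    exact eventually_Qnk_mul_lt_sq hm j
  have hlt : 1 < m₀ ∨ 2 ≤ k → ∀ᶠ n in Filter.atTop,
      ((P n).coeff (k - 1)).eval (m₀ : ℚ) * ((P n).coeff (k + 1)).eval (m₀ : ℚ) <
        ((P n).coeff k).eval (m₀ : ℚ) ^ 2 := by
    intro h
    obtain ⟨j, rfl⟩ := Nat.exists_eq_add_of_le' hk
    exact eventually_eval_coeff_mul_lt_sq hm hP (h.imp_right fun h => by omega)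
  have hle : ∀ᶠ n in Filter.atTop,
      ((P n).coeff (k - 1)).eval (m₀ : ℚ) * ((P n).coeff (k + 1)).eval (m₀ : ℚ) ≤
        ((P n).coeff k).eval (m₀ : ℚ) ^ 2 := by
    by_cases h : 1 < m₀ ∨ 2 ≤ k
    · exact (hlt h).mono fun n hn => hn.le
    · obtain rfl : m₀ = 1 := by omega
      obtain rfl : k = 1 := by omega
      filter_upwards [Filter.eventually_ge_atTop 6] with n hn
      obtain ⟨n, rfl⟩ := Nat.exists_eq_add_of_le' hn
      exact eval_coeff_mul_le_sq_of_one hP n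
  refine ⟨Filter.eventually_atTop.1 ?_, fun h => Filter.eventually_atTop.1 ?_⟩
  · filter_upwards [hle, hQ] with n h1 h2
    exact ⟨h1, h2.le⟩
  · filter_upwards [hlt (Or.inl h), hQ] with n h1 h2
    exact ⟨h1, h2⟩
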